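/- arXiv:math/9603212 — 3 statements merged into one kernel-verified Lean document; each statement's English description precedes it below -/
import Mathlib

section
/- Let H be a nontrivial complex Hilbert space, let R be a bounded operator on H with R² = 0, and suppose R*R + RR* = λ·I for some real number λ ≥ 0. Then ‖R‖² = λ. -/
/-- If `R` is a bounded operator on a nontrivial complex Hilbert space with
`R ^ 2 = 0` and `R⋆ R + R R⋆ = λ • 1` for some real `λ ≥ 0`, then `‖R‖ ^ 2 = λ`. -/
theorem norm_sq_eq_of_sq_eq_zero_of_adjoint_comm {H : Type*} [NormedAddCommGroup H]
    [InnerProductSpace ℂ H] [CompleteSpace H] [Nontrivial H]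
    (R : H →L[ℂ] H) (lam : ℝ) (hlam : 0 ≤ lam)
    (hsq : R ^ 2 = 0)
    (hcar : ContinuousLinearMap.adjoint R * R + R * ContinuousLinearMap.adjoint R
      = (lam : ℂ) • (1 : H →L[ℂ] H)) :
    ‖R‖ ^ 2 = lam := by
  rw [← ContinuousLinearMap.star_eq_adjoint] at hcar
  have hRR : R * star R * R = (lam : ℂ) • R := by
    have h := congrArg (· * R) hcar
    simpa only [add_mul, mul_assoc, ← sq, hsq, mul_zero, zero_add, smul_mul_assoc, one_mul]
      using h
  have hP : star (star R * R) * (star R * R) = (lam : ℂ) • (star R * R) := by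
    rw [star_mul, star_star, mul_assoc, ← mul_assoc R, hRR, mul_smul_comm]
  have hnorm : ‖R‖ ^ 2 * ‖R‖ ^ 2 = lam * ‖R‖ ^ 2 := by
    have h := congrArg norm hP
    rwa [CStarRing.norm_star_mul_self, norm_smul, CStarRing.norm_star_mul_self,
      Complex.norm_of_nonneg hlam, ← sq ‖R‖] at h
  by_cases hR : R = 0
  · have h : (lam : ℂ) • (1 : H →L[ℂ] H) = 0 := by simpa [hR] using hcar.symm
    have hlam0 : lam = 0 := by simpa using h
    simp [hR, hlam0]
  · exact mul_right_cancel₀ (pow_ne_zero 2 (norm_ne_zero_iff.mpr hR)) hnorm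
end

section
/- Let B be an N×N complex matrix with ‖B‖ ≤ 1, let A be an invertible N×N complex matrix, and set R = A⁻¹BA. Then for every m×m-matrix-valued polynomial P(z) = ∑_{j=0}^d z^j D_j (with each D_j an m×m complex matrix), one has ‖∑_{j=0}^d R^j ⊗ D_j‖ ≤ ‖A⁻¹‖ · ‖A‖ · sup_{|z| ≤ 1} ‖P(z)‖, where R^j ⊗ D_j denotes the Kronecker product. -/
open Matrix Kronecker

section Hilbert

open scoped ZMod InnerProductSpace

variable {H : Type*} [NormedAddCommGroup H] [InnerProductSpace ℂ H]

/-- **Plancherel's formula** for the discrete Fourier transform with values in an inner product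
space. -/
theorem ZMod.sum_norm_sq_dft {n : ℕ} [NeZero n] (Φ : ZMod n → H) :
    ∑ l, ‖𝓕 Φ l‖ ^ 2 = n * ∑ k, ‖Φ k‖ ^ 2 := by
  have key : ∑ l, ⟪𝓕 Φ l, 𝓕 Φ l⟫_ℂ = n * ∑ k, ⟪Φ k, Φ k⟫_ℂ := by
    calc ∑ l, ⟪𝓕 Φ l, 𝓕 Φ l⟫_ℂ
        = ∑ l, ∑ k, ⟪Φ k, stdAddChar (k * l) • 𝓕 Φ l⟫_ℂ := by
          refine Finset.sum_congr rfl fun l _ ↦ ?_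
          conv_lhs => rw [dft_apply, sum_inner]
          refine Finset.sum_congr rfl fun k _ ↦ ?_
          rw [inner_smul_left, inner_smul_right, ← AddChar.map_neg_eq_conj, neg_neg,
            dft_apply Φ l]
      _ = ∑ k, ⟪Φ k, 𝓕 (𝓕 Φ) (-k)⟫_ℂ := by
          rw [Finset.sum_comm]
          refine Finset.sum_congr rfl fun k _ ↦ ?_
          rw [dft_apply (𝓕 Φ), inner_sum]
          refine Finset.sum_congr rfl fun l _ ↦ ?_
          rw [mul_neg, neg_neg, mul_comm]
      _ = n * ∑ k, ⟪Φ k, Φ k⟫_ℂ := by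
          simp [dft_dft, Finset.mul_sum]
  simp only [inner_self_eq_norm_sq_to_K] at key
  refine Complex.ofReal_injective ?_
  push_cast
  exact key

theorem sum_norm_sq_circulant_le {d n : ℕ} [NeZero n] (E : Fin (d + 1) → H →L[ℂ] H) {M : ℝ}
    (hM : ∀ z : ℂ, ‖z‖ = 1 → ‖∑ j : Fin (d + 1), z ^ j.val • E j‖ ≤ M) (Φ : ZMod n → H) :
    ∑ k, ‖∑ j : Fin (d + 1), E j (Φ (k + (j.val : ZMod n)))‖ ^ 2 ≤ M ^ 2 * ∑ k, ‖Φ k‖ ^ 2 := by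
  set Ψ : ZMod n → H := fun k ↦ ∑ j : Fin (d + 1), E j (Φ (k + (j.val : ZMod n))) with hΨ
  have hdft (l : ZMod n) :
      𝓕 Ψ l = (∑ j : Fin (d + 1), (ZMod.stdAddChar l : ℂ) ^ j.val • E j) (𝓕 Φ l) := by
    simp only [ZMod.dft_apply, hΨ, Finset.smul_sum, _root_.sum_apply,
      _root_.smul_apply, map_sum, map_smul]
    rw [Finset.sum_comm]
    conv_rhs => rw [Finset.sum_comm]
    refine Finset.sum_congr rfl fun j _ ↦ ?_
    refine Fintype.sum_equiv (Equiv.addRight (j.val : ZMod n)) _ _ fun k ↦ ?_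
    rw [Equiv.coe_addRight, smul_smul, ← AddChar.map_nsmul_eq_pow, ← AddChar.map_add_eq_mul]
    congr 2
    rw [nsmul_eq_mul]
    ring
  have hle (l : ZMod n) : ‖𝓕 Ψ l‖ ^ 2 ≤ M ^ 2 * ‖𝓕 Φ l‖ ^ 2 := by
    rw [hdft, ← mul_pow]
    gcongr
    exact ContinuousLinearMap.le_of_opNorm_le _ (hM _ (AddChar.norm_apply _ _)) _
  have hsum := Finset.sum_le_sum fun l (_ : l ∈ Finset.univ) ↦ hle l
  rw [← Finset.mul_sum, ZMod.sum_norm_sq_dft, ZMod.sum_norm_sq_dft, mul_left_comm] at hsum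
  exact le_of_mul_le_mul_left hsum (Nat.cast_pos.2 (NeZero.pos n))

theorem sum_range_norm_sq_sum_shift_le {d L : ℕ} (E : Fin (d + 1) → H →L[ℂ] H) {M : ℝ}
    (hM : ∀ z : ℂ, ‖z‖ = 1 → ‖∑ j : Fin (d + 1), z ^ j.val • E j‖ ≤ M) (y : ℕ → H) :
    ∑ k ∈ Finset.range L, ‖∑ j : Fin (d + 1), E j (y (k + j.val))‖ ^ 2 ≤
      M ^ 2 * ∑ k ∈ Finset.range (L + d + 1), ‖y k‖ ^ 2 := by
  have hcirc := sum_norm_sq_circulant_le (n := L + d + 1) E hM fun k ↦ y k.val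
  have hval (f : ℕ → ℝ) :
      ∑ k : ZMod (L + d + 1), f k.val = ∑ k ∈ Finset.range (L + d + 1), f k :=
    Fin.sum_univ_eq_sum_range f (L + d + 1)
  rw [hval fun k ↦ ‖y k‖ ^ 2] at hcirc
  refine le_trans ?_ hcirc
  have hcast (k : ZMod (L + d + 1)) :
      ‖∑ j : Fin (d + 1), E j (y (k + (j.val : ZMod (L + d + 1))).val)‖ ^ 2 =
        (fun i : ℕ ↦ ‖∑ j : Fin (d + 1),
          E j (y ((i : ZMod (L + d + 1)) + (j.val : ZMod (L + d + 1))).val)‖ ^ 2) k.val := by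
    simp
  rw [Finset.sum_congr rfl fun k _ ↦ hcast k, hval fun i : ℕ ↦ ‖∑ j : Fin (d + 1),
    E j (y ((i : ZMod (L + d + 1)) + (j.val : ZMod (L + d + 1))).val)‖ ^ 2]
  refine le_trans (le_of_eq ?_) (Finset.sum_le_sum_of_subset_of_nonneg
    (Finset.range_subset_range.2 (by lia : L ≤ L + d + 1)) fun _ _ _ ↦ sq_nonneg _)
  refine Finset.sum_congr rfl fun k hk ↦ ?_
  have hk := Finset.mem_range.1 hk
  congr 2
  refine Finset.sum_congr rfl fun j _ ↦ ?_
  rw [← Nat.cast_add, ZMod.val_natCast_of_lt (by lia)]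

variable [CompleteSpace H]

/-- The defect operator of a contraction. -/
theorem exists_defect (T : H →L[ℂ] H) (hT : ‖T‖ ≤ 1) :
    ∃ Δ : H →L[ℂ] H, (∀ v, ‖Δ v‖ ^ 2 + ‖T v‖ ^ 2 = ‖v‖ ^ 2) ∧
      ∀ S, Commute S T → Commute S (star T) → Commute S Δ := by
  have hpos : 0 ≤ 1 - star T * T := by
    rw [sub_nonneg, ← CStarAlgebra.norm_le_one_iff_of_nonneg _ (star_mul_self_nonneg T),
      CStarRing.norm_star_mul_self]
    exact mul_le_one₀ hT (norm_nonneg _) hT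
  refine ⟨CFC.sqrt (1 - star T * T), fun v ↦ ?_, fun S hS hS' ↦ ?_⟩
  · have hsa : star (CFC.sqrt (1 - star T * T)) = CFC.sqrt (1 - star T * T) :=
      (CFC.sqrt_nonneg (1 - star T * T)).isSelfAdjoint
    have hsq (X : H →L[ℂ] H) : ((‖X v‖ ^ 2 : ℝ) : ℂ) = ⟪v, (star X * X) v⟫_ℂ := by
      rw [ContinuousLinearMap.star_eq_adjoint, mul_apply_eq_comp,
        ContinuousLinearMap.adjoint_inner_right, inner_self_eq_norm_sq_to_K]
      simp
    have : ((‖CFC.sqrt (1 - star T * T) v‖ ^ 2 + ‖T v‖ ^ 2 : ℝ) : ℂ) = ((‖v‖ ^ 2 : ℝ) : ℂ) := by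
      rw [Complex.ofReal_add, hsq, hsq, hsa, CFC.sqrt_mul_sqrt_self _ hpos, ← inner_add_right,
        ← _root_.add_apply, sub_add_cancel]
      simp [inner_self_eq_norm_sq_to_K]
    exact_mod_cast this
  · exact (((Commute.one_right S).sub_right (hS'.mul_right hS)).symm.cfcₙ_nnreal _).symm

theorem norm_sum_mul_pow_le_of_norm_lt_one {d : ℕ} (T : H →L[ℂ] H) (hT : ‖T‖ < 1)
    (E : Fin (d + 1) → H →L[ℂ] H) (hE : ∀ j, Commute (E j) T)
    (hE' : ∀ j, Commute (E j) (star T)) {M : ℝ}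
    (hM : ∀ z : ℂ, ‖z‖ = 1 → ‖∑ j : Fin (d + 1), z ^ j.val • E j‖ ≤ M) :
    ‖∑ j : Fin (d + 1), E j * T ^ j.val‖ ≤ M := by
  have hM0 : 0 ≤ M := (norm_nonneg _).trans (hM 1 norm_one)
  obtain ⟨Δ, hΔ, hcomm⟩ := exists_defect T hT.le
  have hsum (L : ℕ) (v : H) :
      ∑ k ∈ Finset.range L, ‖Δ ((T ^ k) v)‖ ^ 2 = ‖v‖ ^ 2 - ‖(T ^ L) v‖ ^ 2 := by
    induction L with
    | zero => simp
    | succ L ih =>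
      have hT' : (T ^ (L + 1)) v = T ((T ^ L) v) := by rw [pow_succ', mul_apply_eq_comp]
      rw [Finset.sum_range_succ, ih, hT']
      linarith [hΔ ((T ^ L) v)]
  refine ContinuousLinearMap.opNorm_le_bound _ hM0 fun x ↦ ?_
  set w := (∑ j : Fin (d + 1), E j * T ^ j.val) x with hw
  have hshift (k : ℕ) : Δ ((T ^ k) w) = ∑ j : Fin (d + 1), E j (Δ ((T ^ (k + j.val)) x)) := by
    simp only [hw, _root_.sum_apply, map_sum]
    refine Finset.sum_congr rfl fun j _ ↦ ?_
    have : Δ * T ^ k * (E j * T ^ j.val) = E j * (Δ * T ^ (k + j.val)) := by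
      have h : Commute (E j) (Δ * T ^ k) :=
        (hcomm _ (hE j) (hE' j)).mul_right ((hE j).pow_right k)
      rw [pow_add, ← mul_assoc, ← h.eq]
      simp only [mul_assoc]
    exact congr($this x)
  have hbound (L : ℕ) : ‖w‖ ^ 2 - ‖(T ^ L) w‖ ^ 2 ≤ (M * ‖x‖) ^ 2 := by
    have h := sum_range_norm_sq_sum_shift_le (L := L) E hM fun k ↦ Δ ((T ^ k) x)
    simp only [← hshift, hsum] at h
    refine h.trans ?_
    rw [mul_pow]
    gcongr
    exact sub_le_self _ (sq_nonneg _)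
  have hlim : Filter.Tendsto (fun L : ℕ ↦ ‖w‖ ^ 2 - ‖(T ^ L) w‖ ^ 2) Filter.atTop
      (nhds (‖w‖ ^ 2)) := by
    have h0 : Filter.Tendsto (fun L : ℕ ↦ (T ^ L) w) Filter.atTop (nhds 0) := by
      exact ((ContinuousLinearMap.apply ℂ H w).continuous.tendsto' 0 0 (map_zero _)).comp
        (tendsto_pow_atTop_nhds_zero_of_norm_lt_one hT)
    simpa using tendsto_const_nhds.sub (h0.norm.pow 2)
  exact (sq_le_sq₀ (norm_nonneg _) (by positivity)).1 (le_of_tendsto' hlim hbound)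

/-- **Von Neumann's inequality** with operator coefficients: the coefficients commute with the
contraction and with its adjoint. -/
theorem norm_sum_mul_pow_le_of_norm_le_one {d : ℕ} (T : H →L[ℂ] H) (hT : ‖T‖ ≤ 1)
    (E : Fin (d + 1) → H →L[ℂ] H) (hE : ∀ j, Commute (E j) T)
    (hE' : ∀ j, Commute (E j) (star T)) {M : ℝ}
    (hM : ∀ z : ℂ, ‖z‖ = 1 → ‖∑ j : Fin (d + 1), z ^ j.val • E j‖ ≤ M) :
    ‖∑ j : Fin (d + 1), E j * T ^ j.val‖ ≤ M := by
  have hcont : Continuous fun r : ℝ ↦ ‖∑ j : Fin (d + 1), E j * ((r : ℂ) • T) ^ j.val‖ := by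
    fun_prop
  have hlim := (hcont.tendsto 1).mono_left (nhdsWithin_le_nhds (s := Set.Iio 1))
  rw [Complex.ofReal_one, one_smul] at hlim
  refine le_of_tendsto hlim ?_
  filter_upwards [Ioo_mem_nhdsLT (zero_lt_one' ℝ)] with r hr
  refine norm_sum_mul_pow_le_of_norm_lt_one _ ?_ E (fun j ↦ (hE j).smul_right _) (fun j ↦ ?_) hM
  · rw [norm_smul, Complex.norm_real, Real.norm_of_nonneg hr.1.le]
    nlinarith [hr.1, hr.2, norm_nonneg T]
  · rw [star_smul]
    exact (hE' j).smul_right _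

end Hilbert

namespace Matrix

variable {l n : Type*} [Fintype l] [DecidableEq l] [Fintype n] [DecidableEq n]

/-- The embedding `X ↦ X ⊗ 1` as a star algebra homomorphism. -/
noncomputable def kroneckerOneStarAlgHom :
    Matrix l l ℂ →⋆ₐ[ℂ] Matrix (l × n) (l × n) ℂ where
  toFun X := X ⊗ₖ (1 : Matrix n n ℂ)
  map_one' := one_kronecker_one
  map_mul' X Y := by rw [← mul_kronecker_mul, one_mul]
  map_zero' := zero_kronecker _
  map_add' X Y := add_kronecker X Y _
  commutes' r := by
    rw [Algebra.algebraMap_eq_smul_one, Algebra.algebraMap_eq_smul_one, smul_kronecker,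
      one_kronecker_one]
  map_star' X := by simp [star_eq_conjTranspose, conjTranspose_kronecker]

/-- The embedding `X ↦ 1 ⊗ X` as a star algebra homomorphism. -/
noncomputable def oneKroneckerStarAlgHom :
    Matrix n n ℂ →⋆ₐ[ℂ] Matrix (l × n) (l × n) ℂ where
  toFun X := (1 : Matrix l l ℂ) ⊗ₖ X
  map_one' := one_kronecker_one
  map_mul' X Y := by rw [← mul_kronecker_mul, one_mul]
  map_zero' := kronecker_zero _
  map_add' X Y := kronecker_add _ X Y
  commutes' r := by
    rw [Algebra.algebraMap_eq_smul_one, Algebra.algebraMap_eq_smul_one, kronecker_smul,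
      one_kronecker_one]
  map_star' X := by simp [star_eq_conjTranspose, conjTranspose_kronecker]

open scoped Matrix.Norms.L2Operator in
theorem norm_toEuclideanCLM_starAlgHom_le (φ : Matrix l l ℂ →⋆ₐ[ℂ] Matrix n n ℂ)
    (X : Matrix l l ℂ) :
    ‖toEuclideanCLM (𝕜 := ℂ) (φ X)‖ ≤ ‖toEuclideanCLM (𝕜 := ℂ) X‖ :=
  NonUnitalStarAlgHom.norm_apply_le φ X

/-- **Von Neumann's inequality** for polynomials with matrix coefficients. -/
theorem norm_sum_pow_kronecker_le {d : ℕ} (B : Matrix l l ℂ)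
    (hB : ‖toEuclideanCLM (𝕜 := ℂ) B‖ ≤ 1) (D : Fin (d + 1) → Matrix n n ℂ) {M : ℝ}
    (hM : ∀ z : ℂ, ‖z‖ = 1 →
      ‖toEuclideanCLM (𝕜 := ℂ) (∑ j : Fin (d + 1), z ^ j.val • D j)‖ ≤ M) :
    ‖toEuclideanCLM (𝕜 := ℂ) (∑ j : Fin (d + 1), (B ^ j.val) ⊗ₖ D j)‖ ≤ M := by
  set φ : Matrix l l ℂ →⋆ₐ[ℂ] Matrix (l × n) (l × n) ℂ := kroneckerOneStarAlgHom
  set ψ : Matrix n n ℂ →⋆ₐ[ℂ] Matrix (l × n) (l × n) ℂ := oneKroneckerStarAlgHom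
  have hmul (X : Matrix l l ℂ) (Y : Matrix n n ℂ) : ψ Y * φ X = X ⊗ₖ Y := by
    change (1 ⊗ₖ Y) * (X ⊗ₖ 1) = _
    rw [← mul_kronecker_mul, one_mul, mul_one]
  have hcomm (X : Matrix l l ℂ) (Y : Matrix n n ℂ) : Commute (ψ Y) (φ X) := by
    refine (hmul X Y).trans ?_
    change _ = (X ⊗ₖ 1) * (1 ⊗ₖ Y)
    rw [← mul_kronecker_mul, one_mul, mul_one]
  have h := norm_sum_mul_pow_le_of_norm_le_one (toEuclideanCLM (𝕜 := ℂ) (φ B))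
    ((norm_toEuclideanCLM_starAlgHom_le φ B).trans hB)
    (fun j ↦ toEuclideanCLM (𝕜 := ℂ) (ψ (D j))) (fun j ↦ (hcomm B (D j)).map _)
    (fun j ↦ by
      rw [← map_star, ← map_star]
      exact (hcomm (star B) (D j)).map _)
    (M := M) (fun z hz ↦ by
      simp only [← map_smul, ← map_sum]
      exact (norm_toEuclideanCLM_starAlgHom_le ψ _).trans (hM z hz))
  simpa only [← map_pow, ← map_mul, ← map_sum, hmul] using h

end Matrix

/-- If `B` is a contraction, `A` is invertible and `R = A⁻¹ B A`, then for every
matrix-valued polynomial `P(z) = ∑ j, z ^ j • D j` one has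
`‖∑ j, R ^ j ⊗ D j‖ ≤ ‖A⁻¹‖ ‖A‖ sup_{|z| ≤ 1} ‖P(z)‖`. -/
theorem norm_matrixPoly_of_similar_contraction {N m d : ℕ}
    (B A : Matrix (Fin N) (Fin N) ℂ) (hA : IsUnit A)
    (hB : ‖Matrix.toEuclideanCLM (𝕜 := ℂ) B‖ ≤ 1)
    (R : Matrix (Fin N) (Fin N) ℂ) (hR : R = A⁻¹ * B * A)
    (D : Fin (d + 1) → Matrix (Fin m) (Fin m) ℂ) :
    ‖Matrix.toEuclideanCLM (𝕜 := ℂ) (∑ j : Fin (d + 1), (R ^ j.val) ⊗ₖ D j)‖ ≤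
      ‖Matrix.toEuclideanCLM (𝕜 := ℂ) A⁻¹‖ * ‖Matrix.toEuclideanCLM (𝕜 := ℂ) A‖ *
        ⨆ z : Metric.closedBall (0 : ℂ) 1,
          ‖Matrix.toEuclideanCLM (𝕜 := ℂ) (∑ j : Fin (d + 1), ((z : ℂ) ^ j.val) • D j)‖ := by
  set φ : Matrix (Fin N) (Fin N) ℂ →⋆ₐ[ℂ] Matrix (Fin N × Fin m) (Fin N × Fin m) ℂ :=
    kroneckerOneStarAlgHom
  have hdet : IsUnit A.det := (isUnit_iff_isUnit_det A).1 hA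
  have hpow (j : ℕ) : R ^ j = A⁻¹ * B ^ j * A := by
    induction j with
    | zero => simp [nonsing_inv_mul A hdet]
    | succ j ih =>
      rw [pow_succ, ih, hR, pow_succ]
      simp only [mul_assoc, mul_nonsing_inv_cancel_left A _ hdet]
  have hsum : ∑ j : Fin (d + 1), (R ^ j.val) ⊗ₖ D j =
      φ A⁻¹ * (∑ j : Fin (d + 1), (B ^ j.val) ⊗ₖ D j) * φ A := by
    rw [Finset.mul_sum, Finset.sum_mul]
    refine Finset.sum_congr rfl fun j _ ↦ ?_
    change _ = (A⁻¹ ⊗ₖ 1) * _ * (A ⊗ₖ 1)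
    rw [← mul_kronecker_mul, ← mul_kronecker_mul, one_mul, mul_one, hpow]
  have hbdd : BddAbove (Set.range fun z : Metric.closedBall (0 : ℂ) 1 ↦
      ‖Matrix.toEuclideanCLM (𝕜 := ℂ) (∑ j : Fin (d + 1), ((z : ℂ) ^ j.val) • D j)‖) := by
    have : CompactSpace (Metric.closedBall (0 : ℂ) 1) :=
      isCompact_iff_compactSpace.1 (isCompact_closedBall 0 1)
    simp only [map_sum, map_smul]
    exact (isCompact_range (by fun_prop)).bddAbove
  have hvN := norm_sum_pow_kronecker_le B hB D fun z hz ↦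
    le_ciSup hbdd ⟨z, mem_closedBall_zero_iff.2 hz.le⟩
  rw [hsum, map_mul, map_mul]
  refine (norm_mul_le_of_le (norm_mul_le_of_le (norm_toEuclideanCLM_starAlgHom_le φ A⁻¹) hvN)
    (norm_toEuclideanCLM_starAlgHom_le φ A)).trans (le_of_eq ?_)
  ring
end

section
/- There exists a bounded linear operator T on the complex Hilbert space ℓ²(ℕ, ℂ) such that: (1) T is polynomially bounded, i.e., there is a constant C > 0 with ‖p(T)‖ ≤ C · sup_{|z| ≤ 1} |p(z)| for every complex polynomial p; and (2) T is not similar to a contraction, i.e., for every invertible bounded linear operator A on ℓ²(ℕ, ℂ) with bounded inverse, ‖A T A⁻¹‖ > 1. -/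
section Construction

open MeasureTheory Complex
open scoped ComplexConjugate InnerProductSpace

noncomputable instance Circle.instMeasurableSpaceBorel : MeasurableSpace Circle := borel Circle

instance Circle.instBorelSpaceBorel : BorelSpace Circle := ⟨rfl⟩

/-- The normalized Haar measure of the circle. -/
noncomputable def circleHaar : Measure Circle := Measure.haarMeasure ⊤

instance : IsProbabilityMeasure circleHaar := by
  constructor
  have := Measure.haarMeasure_self (K₀ := (⊤ : TopologicalSpace.PositiveCompacts Circle))
  simpa [circleHaar] using this

instance : circleHaar.IsMulLeftInvariant := by
  unfold circleHaar; infer_instance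

theorem Continuous.integrable_circleHaar {E : Type*} [NormedAddCommGroup E] {F : Circle → E}
    (hF : Continuous F) : Integrable F circleHaar :=
  hF.integrable_of_hasCompactSupport (HasCompactSupport.of_compactSpace F)


theorem integral_circle_zpow {n : ℤ} (hn : n ≠ 0) :
    ∫ z : Circle, (z : ℂ) ^ n ∂circleHaar = 0 := by
  obtain ⟨w, hw⟩ : ∃ w : Circle, (w : ℂ) ^ n ≠ 1 := by
    refine ⟨Circle.exp (Real.pi / n), ?_⟩
    rw [Circle.coe_exp, ← Complex.exp_int_mul]
    have : (n : ℂ) ≠ 0 := by exact_mod_cast hn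
    have h : (n : ℂ) * (((Real.pi / n : ℝ) : ℂ) * I) = Real.pi * I := by
      push_cast; field_simp
    rw [h, Complex.exp_pi_mul_I]; norm_num
  have h1 := integral_mul_left_eq_self (μ := circleHaar) (fun z : Circle => (z : ℂ) ^ n) w
  simp only [Circle.coe_mul, mul_zpow] at h1
  rw [integral_const_mul] at h1
  have h2 : ((w : ℂ) ^ n - 1) * ∫ z : Circle, (z : ℂ) ^ n ∂circleHaar = 0 := by
    rw [sub_mul, h1, one_mul, sub_self]
  exact (mul_eq_zero.mp h2).resolve_left (sub_ne_zero.mpr hw)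

theorem integral_circle_conj_pow_mul_pow (m n : ℕ) :
    ∫ z : Circle, conj (z : ℂ) ^ m * (z : ℂ) ^ n ∂circleHaar = if m = n then 1 else 0 := by
  have h : ∀ z : Circle, conj (z : ℂ) ^ m * (z : ℂ) ^ n = (z : ℂ) ^ ((n : ℤ) - m) := by
    intro z
    rw [zpow_sub₀ (Circle.coe_ne_zero z), ← Circle.coe_inv_eq_conj, Circle.coe_inv]
    simp [div_eq_mul_inv, mul_comm]
  simp only [h]
  split_ifs with hmn
  · subst hmn; simp
  · exact integral_circle_zpow (by omega)



theorem exists_blaschke {ρ : ℝ} (h0 : 0 ≤ ρ) (h1 : ρ < 1) :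
    ∃ b : Circle → Circle, Continuous b ∧
      ∀ z : Circle, (b z : ℂ) * (1 + ρ * z) = ρ + z := by
  have hu : ∀ z : Circle, (1 + ρ * z : ℂ) ≠ 0 := by
    intro z hz
    have h : ‖(ρ * z : ℂ)‖ = 1 := by
      rw [show (ρ * z : ℂ) = -1 by linear_combination hz]; simp
    simp [abs_of_nonneg h0, Circle.norm_coe] at h
    linarith
  refine ⟨fun z => z * Circle.ofConjDivSelf (1 + ρ * z) (hu z), ?_, fun z => ?_⟩
  · refine continuous_id.mul (Continuous.subtype_mk ?_ _)
    refine Continuous.div ?_ (by fun_prop) hu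
    exact Complex.continuous_conj.comp (by fun_prop)
  · have hz : (z : ℂ) * conj (z : ℂ) = 1 := by
      rw [← Circle.coe_inv_eq_conj]; simp
    have hc : ((z * Circle.ofConjDivSelf (1 + ρ * z) (hu z) : Circle) : ℂ)
        = z * (conj (1 + ρ * z : ℂ) / (1 + ρ * z)) := rfl
    rw [hc, mul_assoc, div_mul_cancel₀ _ (hu z)]
    simp only [map_add, map_one, map_mul, Complex.conj_ofReal]
    linear_combination (ρ : ℂ) * hz

theorem Circle.continuous_coe : Continuous (fun z : Circle => (z : ℂ)) := by fun_prop

section BlaschkeMoments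

variable {ρ : ℝ} {b : Circle → Circle}

theorem blaschke_moment_rec (hbc : Continuous b)
    (hb : ∀ z : Circle, (b z : ℂ) * (1 + ρ * z) = ρ + z) (n : ℕ) (k : ℤ) :
    ∫ z : Circle, (z : ℂ) ^ k * (b z : ℂ) ^ (n + 1) ∂circleHaar
      + ρ * ∫ z : Circle, (z : ℂ) ^ (k + 1) * (b z : ℂ) ^ (n + 1) ∂circleHaar
    = ρ * ∫ z : Circle, (z : ℂ) ^ k * (b z : ℂ) ^ n ∂circleHaar
      + ∫ z : Circle, (z : ℂ) ^ (k + 1) * (b z : ℂ) ^ n ∂circleHaar := by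
  have hint : ∀ (k : ℤ) (n : ℕ),
      Integrable (fun z : Circle => (z : ℂ) ^ k * (b z : ℂ) ^ n) circleHaar := by
    intro k n
    refine Continuous.integrable_circleHaar (Continuous.mul ?_ ?_)
    · exact Circle.continuous_coe.zpow₀ k fun z => Or.inl (Circle.coe_ne_zero z)
    · exact (Circle.continuous_coe.comp hbc).pow n
  rw [← integral_const_mul, ← integral_const_mul, ← integral_add (hint _ _)
      ((hint _ _).const_mul _),
    ← integral_add ((hint _ _).const_mul _) (hint _ _)]
  congr 1
  ext z
  rw [zpow_add_one₀ (Circle.coe_ne_zero z), pow_succ]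
  linear_combination ((z : ℂ) ^ k * (b z : ℂ) ^ n) * hb z

theorem blaschke_moment_pos (h0 : 0 ≤ ρ) (h1 : ρ < 1) (hbc : Continuous b)
    (hb : ∀ z : Circle, (b z : ℂ) * (1 + ρ * z) = ρ + z) (n : ℕ) (k : ℤ) (hk : 0 < k) :
    ∫ z : Circle, (z : ℂ) ^ k * (b z : ℂ) ^ n ∂circleHaar = 0 := by
  induction n generalizing k with
  | zero => simpa using integral_circle_zpow hk.ne'
  | succ n ih =>
    have hle : ∀ k : ℤ, ‖∫ z : Circle, (z : ℂ) ^ k * (b z : ℂ) ^ (n + 1) ∂circleHaar‖ ≤ 1 := by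
      intro k
      refine (norm_integral_le_of_norm_le_const (C := 1) (.of_forall fun z => ?_)).trans ?_
      · simp [Circle.norm_coe]
      · simp
    have hdecay : ∀ (j : ℕ) (k : ℤ), 0 < k →
        ‖∫ z : Circle, (z : ℂ) ^ k * (b z : ℂ) ^ (n + 1) ∂circleHaar‖ ≤ ρ ^ j := by
      intro j
      induction j with
      | zero => intro k _; simpa using hle k
      | succ j ihj =>
        intro k hk
        have h := blaschke_moment_rec hbc hb n k
        rw [ih k hk, ih (k + 1) (by omega), mul_zero, add_zero] at h
        rw [eq_neg_of_add_eq_zero_left h, norm_neg, norm_mul, Complex.norm_real,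
          Real.norm_of_nonneg h0, pow_succ']
        exact mul_le_mul_of_nonneg_left (ihj (k + 1) (by omega)) h0
    have ht := tendsto_pow_atTop_nhds_zero_of_lt_one h0 h1
    exact norm_le_zero_iff.mp (ge_of_tendsto' ht fun j => hdecay j k hk)

theorem integral_blaschke_pow (h0 : 0 ≤ ρ) (h1 : ρ < 1) (hbc : Continuous b)
    (hb : ∀ z : Circle, (b z : ℂ) * (1 + ρ * z) = ρ + z) (n : ℕ) :
    ∫ z : Circle, (b z : ℂ) ^ n ∂circleHaar = (ρ : ℂ) ^ n := by
  induction n with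
  | zero => simp
  | succ n ih =>
    have h := blaschke_moment_rec hbc hb n 0
    rw [blaschke_moment_pos h0 h1 hbc hb _ (0 + 1) (by norm_num),
      blaschke_moment_pos h0 h1 hbc hb _ (0 + 1) (by norm_num)] at h
    simp only [zpow_zero, one_mul, mul_zero, add_zero] at h
    rw [h, ih, pow_succ']

theorem integral_conj_mul_blaschke_pow (h0 : 0 ≤ ρ) (h1 : ρ < 1) (hbc : Continuous b)
    (hb : ∀ z : Circle, (b z : ℂ) * (1 + ρ * z) = ρ + z) (n : ℕ) :
    ∫ z : Circle, conj (z : ℂ) * (b z : ℂ) ^ n ∂circleHaar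
      = n * (ρ : ℂ) ^ (n - 1) * (1 - (ρ : ℂ) ^ 2) := by
  have hz : ∀ z : Circle, conj (z : ℂ) = (z : ℂ) ^ (-1 : ℤ) := by
    intro z; rw [← Circle.coe_inv_eq_conj, Circle.coe_inv, zpow_neg_one]
  simp only [hz]
  induction n with
  | zero => simpa using integral_circle_zpow (n := -1) (by norm_num)
  | succ n ih =>
    have h := blaschke_moment_rec hbc hb n (-1)
    simp only [neg_add_cancel, zpow_zero, one_mul, integral_blaschke_pow h0 h1 hbc hb, ih] at h
    rw [eq_sub_of_add_eq h]
    rcases n with _ | n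
    · simp; ring
    · simp only [Nat.add_sub_cancel]; push_cast; ring

end BlaschkeMoments

/-- The vector-valued polynomial `z ↦ ∑ j < n, z ^ j • x j`. -/
noncomputable def vecPoly {H : Type*} [AddCommGroup H] [Module ℂ H] (x : ℕ → H) (n : ℕ)
    (z : ℂ) : H :=
  ∑ j ∈ Finset.range n, z ^ j • x j

section VecPoly

variable {H : Type*} [NormedAddCommGroup H] [InnerProductSpace ℂ H]

@[fun_prop]
theorem continuous_vecPoly (x : ℕ → H) (n : ℕ) : Continuous (vecPoly x n) := by
  unfold vecPoly; fun_prop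

theorem integral_norm_sq_vecPoly_comp {φ : Circle → ℂ} (hφ : Continuous φ)
    (h : ∀ i j : ℕ, ∫ z, conj (φ z) ^ i * φ z ^ j ∂circleHaar = if i = j then 1 else 0)
    (x : ℕ → H) (n : ℕ) (r : ℝ) :
    ∫ z : Circle, ‖vecPoly x n (r * φ z)‖ ^ 2 ∂circleHaar
      = ∑ j ∈ Finset.range n, r ^ (2 * j) * ‖x j‖ ^ 2 := by
  have hnorm : ∀ v : H, ((‖v‖ ^ 2 : ℝ) : ℂ) = ⟪v, v⟫_ℂ := fun v => by
    rw [inner_self_eq_norm_sq_to_K (𝕜 := ℂ)]; simp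
  have hexp : ∀ z : Circle, ((‖vecPoly x n (r * φ z)‖ ^ 2 : ℝ) : ℂ)
      = ∑ i ∈ Finset.range n, ∑ j ∈ Finset.range n,
        (r ^ (i + j) * ⟪x i, x j⟫_ℂ) * (conj (φ z) ^ i * φ z ^ j) := by
    intro z
    rw [hnorm, vecPoly, sum_inner]
    refine Finset.sum_congr rfl fun i _ => ?_
    rw [inner_sum]
    refine Finset.sum_congr rfl fun j _ => ?_
    rw [inner_smul_left, inner_smul_right, map_pow, map_mul, Complex.conj_ofReal]
    ring
  have hci : ∀ i j : ℕ, Integrable (fun z : Circle =>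
      (r ^ (i + j) * ⟪x i, x j⟫_ℂ) * (conj (φ z) ^ i * φ z ^ j)) circleHaar := by
    intro i j
    refine Continuous.integrable_circleHaar ?_
    have := Complex.continuous_conj.comp hφ
    simp only [Function.comp_def] at this
    fun_prop
  apply Complex.ofReal_injective
  rw [← integral_complex_ofReal]
  simp only [hexp]
  rw [integral_finsetSum _ fun i _ => integrable_finsetSum _ fun j _ => hci i j,
    Complex.ofReal_sum]
  refine Finset.sum_congr rfl fun i hi => ?_
  rw [integral_finsetSum _ fun j _ => hci i j]
  simp only [integral_const_mul, h, mul_ite, mul_one, mul_zero]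
  rw [Finset.sum_ite_eq, if_pos hi, Complex.ofReal_mul, hnorm]
  simp [two_mul]

theorem integral_norm_sq_vecPoly (x : ℕ → H) (n : ℕ) (r : ℝ) :
    ∫ z : Circle, ‖vecPoly x n (r * z)‖ ^ 2 ∂circleHaar
      = ∑ j ∈ Finset.range n, r ^ (2 * j) * ‖x j‖ ^ 2 :=
  integral_norm_sq_vecPoly_comp Circle.continuous_coe integral_circle_conj_pow_mul_pow x n r

theorem integral_norm_sq_vecPoly_conj (x : ℕ → H) (n : ℕ) (r : ℝ) :
    ∫ z : Circle, ‖vecPoly x n (conj (r * z : ℂ))‖ ^ 2 ∂circleHaar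
      = ∑ j ∈ Finset.range n, r ^ (2 * j) * ‖x j‖ ^ 2 := by
  simp only [map_mul, Complex.conj_ofReal]
  refine integral_norm_sq_vecPoly_comp (φ := fun z : Circle => conj (z : ℂ))
    (Complex.continuous_conj.comp Circle.continuous_coe) (fun i j => ?_) x n r
  simp only [Complex.conj_conj, mul_comm (_ ^ i), integral_circle_conj_pow_mul_pow, eq_comm]

theorem integral_vecPoly_comp [CompleteSpace H] {φ : Circle → ℂ} (hφ : Continuous φ) (w : ℂ)
    (h : ∀ n : ℕ, ∫ z, φ z ^ n ∂circleHaar = w ^ n) (x : ℕ → H) (n : ℕ) :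
    ∫ z, vecPoly x n (φ z) ∂circleHaar = vecPoly x n w := by
  simp only [vecPoly]
  rw [integral_finsetSum _ fun j _ => Continuous.integrable_circleHaar (by fun_prop)]
  simp only [integral_smul_const, h]

end VecPoly

section BlaschkeMeans

variable {ρ : ℝ} {b : Circle → Circle}

theorem integral_mul_blaschke_pow (h0 : 0 ≤ ρ) (h1 : ρ < 1) (hbc : Continuous b)
    (hb : ∀ z : Circle, (b z : ℂ) * (1 + ρ * z) = ρ + z) (c : ℂ) (n : ℕ) :
    ∫ z, (c * b z) ^ n ∂circleHaar = (c * ρ) ^ n := by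
  simp only [mul_pow]
  rw [integral_const_mul, integral_blaschke_pow h0 h1 hbc hb]

theorem integral_conj_mul_blaschke_pow' (h0 : 0 ≤ ρ) (h1 : ρ < 1) (hbc : Continuous b)
    (hb : ∀ z : Circle, (b z : ℂ) * (1 + ρ * z) = ρ + z) (c : ℂ) (n : ℕ) :
    ∫ z, (conj (c * b z)) ^ n ∂circleHaar = (conj (c * ρ)) ^ n := by
  simp only [← map_pow]
  rw [integral_conj, integral_mul_blaschke_pow h0 h1 hbc hb]

theorem integral_eval_blaschke (h0 : 0 ≤ ρ) (h1 : ρ < 1) (hbc : Continuous b)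
    (hb : ∀ z : Circle, (b z : ℂ) * (1 + ρ * z) = ρ + z) (f : Polynomial ℂ) (c : ℂ) :
    ∫ z, f.eval (c * b z) ∂circleHaar = f.eval (c * ρ) := by
  simp only [Polynomial.eval_eq_sum_range]
  rw [integral_finsetSum _ fun j _ => Continuous.integrable_circleHaar (by fun_prop)]
  simp only [integral_const_mul, integral_mul_blaschke_pow h0 h1 hbc hb]

theorem integral_conj_mul_eval_blaschke (h0 : 0 ≤ ρ) (h1 : ρ < 1) (hbc : Continuous b)
    (hb : ∀ z : Circle, (b z : ℂ) * (1 + ρ * z) = ρ + z) (f : Polynomial ℂ) (c : ℂ) :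
    ∫ z, conj (z : ℂ) * f.eval (c * b z) ∂circleHaar
      = f.derivative.eval (c * ρ) * c * (1 - (ρ : ℂ) ^ 2) := by
  have hcc : Continuous fun z : Circle => conj (z : ℂ) :=
    Complex.continuous_conj.comp Circle.continuous_coe
  induction f using Polynomial.induction_on' with
  | add p q hp hq =>
    simp only [Polynomial.eval_add, mul_add, Polynomial.derivative_add, add_mul]
    rw [integral_add, hp, hq] <;> refine Continuous.integrable_circleHaar ?_
    · exact hcc.mul (p.continuous.comp (by fun_prop))
    · exact hcc.mul (q.continuous.comp (by fun_prop))
  | monomial n a =>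
    simp only [Polynomial.eval_monomial, Polynomial.derivative_monomial, mul_pow]
    have : ∀ z : Circle, conj (z : ℂ) * (a * (c ^ n * (b z : ℂ) ^ n))
        = (a * c ^ n) * (conj (z : ℂ) * (b z : ℂ) ^ n) := fun z => by ring
    simp only [this]
    rw [integral_const_mul, integral_conj_mul_blaschke_pow h0 h1 hbc hb]
    rcases n with _ | n
    · simp
    · simp only [Nat.add_sub_cancel]; push_cast; ring

end BlaschkeMeans

section MeanEstimates

variable {H V : Type*} [NormedAddCommGroup H] [InnerProductSpace ℂ H] [CompleteSpace H]
  [NormedAddCommGroup V] [InnerProductSpace ℂ V] [CompleteSpace V]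

theorem integral_inner_const {F : Circle → H} (hF : Continuous F) (c : H) :
    ∫ z, ⟪c, F z⟫_ℂ ∂circleHaar = ⟪c, ∫ z, F z ∂circleHaar⟫_ℂ :=
  integral_inner hF.integrable_circleHaar c

theorem integral_re_inner_const {F : Circle → H} (hF : Continuous F) (c : H) :
    ∫ z, (⟪c, F z⟫_ℂ).re ∂circleHaar = (⟪c, ∫ z, F z ∂circleHaar⟫_ℂ).re := by
  rw [← integral_inner_const hF]
  exact integral_re (f := fun z => ⟪c, F z⟫_ℂ) (Continuous.integrable_circleHaar (by fun_prop))

theorem integral_sub_mean {F : Circle → H} (hF : Continuous F) :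
    ∫ z, (F z - ∫ w, F w ∂circleHaar) ∂circleHaar = 0 := by
  rw [integral_sub hF.integrable_circleHaar (integrable_const _)]
  simp

theorem integral_norm_sub_mean_sq {F : Circle → H} (hF : Continuous F) :
    ∫ z, ‖F z - ∫ w, F w ∂circleHaar‖ ^ 2 ∂circleHaar
      = ∫ z, ‖F z‖ ^ 2 ∂circleHaar - ‖∫ z, F z ∂circleHaar‖ ^ 2 := by
  set m := ∫ w, F w ∂circleHaar with hm
  have h : ∀ z, ‖F z - m‖ ^ 2 = ‖F z‖ ^ 2 - 2 * (⟪m, F z⟫_ℂ).re + ‖m‖ ^ 2 := by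
    intro z
    rw [norm_sub_sq (𝕜 := ℂ), inner_re_symm]
    rfl
  simp only [h]
  rw [integral_add, integral_sub, integral_const_mul, integral_re_inner_const hF, ← hm,
    ← RCLike.re_eq_complex_re, inner_self_eq_norm_sq]
  · simp; ring
  all_goals exact Continuous.integrable_circleHaar (by fun_prop)

theorem two_mul_re_inner_div_le {H : Type*} [NormedAddCommGroup H] [InnerProductSpace ℂ H]
    (x y : H) {a t : ℝ} (ha : 0 < a) (ht : 0 < t) :
    2 * (⟪x, y⟫_ℂ).re / a - t * ‖x‖ ^ 2 / a ^ 2 ≤ ‖y‖ ^ 2 / t := by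
  have h1 : (⟪x, y⟫_ℂ).re ≤ ‖x‖ * ‖y‖ := (Complex.re_le_norm _).trans (norm_inner_le_norm x y)
  have h2 : 0 ≤ (‖y‖ - t * ‖x‖ / a) ^ 2 / t := by positivity
  have h3 : (‖y‖ - t * ‖x‖ / a) ^ 2 / t
      = ‖y‖ ^ 2 / t - 2 * (‖x‖ * ‖y‖) / a + t * ‖x‖ ^ 2 / a ^ 2 := by
    field_simp; ring
  have h4 : 2 * (⟪x, y⟫_ℂ).re / a ≤ 2 * (‖x‖ * ‖y‖) / a := by gcongr
  linarith

theorem weighted_mean_le {g : Circle → H} (hg : Continuous g) {A : Circle → ℝ} (hA : Continuous A)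
    (hA0 : ∀ z, 0 ≤ A z) {a q : ℝ} (ha : 1 ≤ a) (ha' : a ≤ 65) (hq : 0 ≤ q)
    (haq : 1 + ∫ z, A z ∂circleHaar ≤ a - q) :
    ‖∫ z, g z ∂circleHaar‖ ^ 2 * (7 + 4225 / a)
      + 7 * ∫ z, ‖g z - ∫ w, g w ∂circleHaar‖ ^ 2 ∂circleHaar
      + q * ‖∫ z, g z ∂circleHaar‖ ^ 2
    ≤ ∫ z, ‖g z‖ ^ 2 * (7 + 4225 / (1 + A z)) ∂circleHaar := by
  rw [integral_norm_sub_mean_sq hg]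
  set m := ∫ z, g z ∂circleHaar with hm
  have h1 : ∀ z, 0 < 1 + A z := fun z => by have := hA0 z; linarith
  have key : ∫ z, (7 * ‖g z‖ ^ 2
      + 4225 * (2 / a * (⟪m, g z⟫_ℂ).re - (1 + A z) * (‖m‖ ^ 2 / a ^ 2))) ∂circleHaar
      ≤ ∫ z, ‖g z‖ ^ 2 * (7 + 4225 / (1 + A z)) ∂circleHaar := by
    refine integral_mono (Continuous.integrable_circleHaar (by fun_prop))
      (Continuous.integrable_circleHaar ?_) fun z => ?_
    · exact (by fun_prop : Continuous fun z => ‖g z‖ ^ 2).mul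
        (continuous_const.add (continuous_const.div (by fun_prop) fun z => (h1 z).ne'))
    · have := two_mul_re_inner_div_le m (g z) (by linarith : 0 < a) (h1 z)
      have e1 : ‖g z‖ ^ 2 * (7 + 4225 / (1 + A z))
        = 7 * ‖g z‖ ^ 2 + 4225 * (‖g z‖ ^ 2 / (1 + A z)) := by ring
      have e2 : 2 / a * (⟪m, g z⟫_ℂ).re - (1 + A z) * (‖m‖ ^ 2 / a ^ 2)
        = 2 * (⟪m, g z⟫_ℂ).re / a - (1 + A z) * ‖m‖ ^ 2 / a ^ 2 := by ring
      simp only [e1, e2]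
      linarith
  rw [integral_add, integral_const_mul, integral_const_mul, integral_sub, integral_const_mul,
    integral_mul_const, integral_add, integral_re_inner_const hg, ← hm,
    ← RCLike.re_eq_complex_re, inner_self_eq_norm_sq] at key
  rotate_left
  all_goals try exact Continuous.integrable_circleHaar (by fun_prop)
  simp only [integral_const, probReal_univ, one_smul] at key
  have hdiv : q / 4225 ≤ q / a ^ 2 := by
    apply div_le_div_of_nonneg_left hq (by positivity); nlinarith
  have hm2 : 0 ≤ ‖m‖ ^ 2 := by positivity
  have h5 : (1 + ∫ z, A z ∂circleHaar) * (‖m‖ ^ 2 / a ^ 2) ≤ (a - q) * (‖m‖ ^ 2 / a ^ 2) := by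
    gcongr
  have h6 : (a - q) * (‖m‖ ^ 2 / a ^ 2) = ‖m‖ ^ 2 / a - q / a ^ 2 * ‖m‖ ^ 2 := by
    field_simp
  have h7 : q / 4225 * ‖m‖ ^ 2 ≤ q / a ^ 2 * ‖m‖ ^ 2 := by gcongr
  have e3 : ‖m‖ ^ 2 * (7 + 4225 / a) = 7 * ‖m‖ ^ 2 + 4225 * (‖m‖ ^ 2 / a) := by ring
  have e4 : 2 / a * ‖m‖ ^ 2 = 2 * (‖m‖ ^ 2 / a) := by ring
  rw [e3]
  rw [e4] at key
  linarith

theorem norm_integral_trilinear_sub_le (B : V →L[ℂ] H →L[ℂ] H)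
    (hB : ∀ v x, ‖B v x‖ ≤ 3 / 2 * ‖v‖ * ‖x‖) {g h : Circle → H} {α : Circle → V}
    (hg : Continuous g) (hh : Continuous h) (hα : Continuous α) (hα8 : ∀ z, ‖α z‖ ≤ 8) :
    ‖∫ z, ⟪h z, B (α z) (g z)⟫_ℂ ∂circleHaar
      - ⟪∫ z, h z ∂circleHaar, B (∫ z, α z ∂circleHaar) (∫ z, g z ∂circleHaar)⟫_ℂ‖
    ≤ (∫ z, ‖α z - ∫ w, α w ∂circleHaar‖ ^ 2 ∂circleHaar)
        * (‖∫ z, g z ∂circleHaar‖ ^ 2 + ‖∫ z, h z ∂circleHaar‖ ^ 2)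
      + 7 * ∫ z, ‖g z - ∫ w, g w ∂circleHaar‖ ^ 2 ∂circleHaar
      + 7 * ∫ z, ‖h z - ∫ w, h w ∂circleHaar‖ ^ 2 ∂circleHaar := by
  have hg0 := integral_sub_mean hg
  have hh0 := integral_sub_mean hh
  have hα0 := integral_sub_mean hα
  set g' := ∫ z, g z ∂circleHaar with hg'
  set h' := ∫ z, h z ∂circleHaar with hh'
  set α' := ∫ z, α z ∂circleHaar with hα'
  have i1 : ∫ z, ⟪h', B (α z - α') g'⟫_ℂ ∂circleHaar = 0 := by
    rw [integral_inner_const (F := fun z => B (α z - α') g') (by fun_prop)]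
    have := (B.flip g').integral_comp_comm (μ := circleHaar) (φ := fun z => α z - α')
      (Continuous.integrable_circleHaar (by fun_prop))
    simp only [ContinuousLinearMap.flip_apply] at this
    rw [this, hα0]; simp
  have i2 : ∫ z, ⟪h', B α' (g z - g')⟫_ℂ ∂circleHaar = 0 := by
    rw [integral_inner_const (F := fun z => B α' (g z - g')) (by fun_prop),
      (B α').integral_comp_comm (Continuous.integrable_circleHaar (by fun_prop)), hg0]
    simp
  have i3 : ∫ z, ⟪h z - h', B α' g'⟫_ℂ ∂circleHaar = 0 := by
    have h1 : ∀ z, ⟪h z - h', B α' g'⟫_ℂ = conj ⟪B α' g', h z - h'⟫_ℂ :=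
      fun z => (inner_conj_symm _ _).symm
    simp only [h1]
    rw [integral_conj, integral_inner_const (F := fun z => h z - h') (by fun_prop), hh0]
    simp
  have i0 : ∫ z, (⟪h', B (α z - α') g'⟫_ℂ + ⟪h', B α' (g z - g')⟫_ℂ + ⟪h z - h', B α' g'⟫_ℂ)
      ∂circleHaar = 0 := by
    rw [integral_add (Continuous.integrable_circleHaar (by fun_prop))
      (Continuous.integrable_circleHaar (by fun_prop)),
      integral_add (Continuous.integrable_circleHaar (by fun_prop))
      (Continuous.integrable_circleHaar (by fun_prop)), i1, i2, i3]
    simp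
  have hexp : ∀ z, ⟪h z, B (α z) (g z)⟫_ℂ - ⟪h', B α' g'⟫_ℂ
      = (⟪h z - h', B (α z - α') g'⟫_ℂ + ⟪h', B (α z - α') (g z - g')⟫_ℂ
        + ⟪h z - h', B (α z) (g z - g')⟫_ℂ)
        + (⟪h', B (α z - α') g'⟫_ℂ + ⟪h', B α' (g z - g')⟫_ℂ + ⟪h z - h', B α' g'⟫_ℂ) := by
    intro z
    simp only [map_sub, sub_apply, inner_sub_left, inner_sub_right]
    ring
  have hD : ∫ z, ⟪h z, B (α z) (g z)⟫_ℂ ∂circleHaar - ⟪h', B α' g'⟫_ℂ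
      = ∫ z, (⟪h z - h', B (α z - α') g'⟫_ℂ + ⟪h', B (α z - α') (g z - g')⟫_ℂ
        + ⟪h z - h', B (α z) (g z - g')⟫_ℂ) ∂circleHaar := by
    have e : ⟪h', B α' g'⟫_ℂ = ∫ _ : Circle, ⟪h', B α' g'⟫_ℂ ∂circleHaar := by simp
    rw [e, ← integral_sub]
    · simp only [hexp]
      rw [integral_add (Continuous.integrable_circleHaar (by fun_prop))
        (Continuous.integrable_circleHaar (by fun_prop)), i0, add_zero]
    all_goals exact Continuous.integrable_circleHaar (by fun_prop)
  rw [hD, ← integral_mul_const, ← integral_const_mul, ← integral_const_mul, ← integral_add,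
    ← integral_add]
  rotate_left
  iterate 4 exact Continuous.integrable_circleHaar (by fun_prop)
  refine norm_integral_le_of_norm_le (Continuous.integrable_circleHaar (by fun_prop))
    (.of_forall fun z => ?_)
  have b1 : ‖⟪h z - h', B (α z - α') g'⟫_ℂ‖ ≤ ‖h z - h'‖ * (3 / 2 * ‖α z - α'‖ * ‖g'‖) :=
    (norm_inner_le_norm _ _).trans (by gcongr; exact hB _ _)
  have b2 : ‖⟪h', B (α z - α') (g z - g')⟫_ℂ‖ ≤ ‖h'‖ * (3 / 2 * ‖α z - α'‖ * ‖g z - g'‖) :=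
    (norm_inner_le_norm _ _).trans (by gcongr; exact hB _ _)
  have b3 : ‖⟪h z - h', B (α z) (g z - g')⟫_ℂ‖ ≤ ‖h z - h'‖ * (3 / 2 * 8 * ‖g z - g'‖) :=
    (norm_inner_le_norm _ _).trans (by gcongr; exact (hB _ _).trans (by gcongr; exact hα8 z))
  refine (norm_add₃_le).trans ?_
  nlinarith [sq_nonneg (‖α z - α'‖ * ‖g'‖ - 3 / 4 * ‖h z - h'‖),
    sq_nonneg (‖α z - α'‖ * ‖h'‖ - 3 / 4 * ‖g z - g'‖), sq_nonneg (‖h z - h'‖ - ‖g z - g'‖),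
    sq_nonneg (‖h z - h'‖), sq_nonneg (‖g z - g'‖)]

/-- The potential controlling the telescoping estimate. -/
noncomputable def potential {H : Type*} [NormedAddCommGroup H] (A : ℝ) (g h : H) : ℝ :=
  (‖g‖ ^ 2 + ‖h‖ ^ 2) * (7 + 4225 / (1 + A))

/-- One step of the telescoping estimate: averaging decreases the potential by at least the change
of the trilinear form. -/
theorem potential_step (B : V →L[ℂ] H →L[ℂ] H)
    (hB : ∀ v x, ‖B v x‖ ≤ 3 / 2 * ‖v‖ * ‖x‖) {g h : Circle → H} {α : Circle → V} {f : Circle → ℂ}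
    (hg : Continuous g) (hh : Continuous h) (hα : Continuous α) (hf : Continuous f)
    (hαf : ∀ z, ‖α z‖ ^ 2 ≤ 64 * (1 - ‖f z‖ ^ 2)) {v : V}
    (hαv : ‖(∫ z, α z ∂circleHaar) + v‖ ^ 2 = ‖∫ z, α z ∂circleHaar‖ ^ 2 + ‖v‖ ^ 2)
    (hv : ‖v‖ ^ 2 ≤ 64 * (∫ z, ‖f z‖ ^ 2 ∂circleHaar - ‖∫ z, f z ∂circleHaar‖ ^ 2)) :
    ‖∫ z, ⟪h z, B (α z) (g z)⟫_ℂ ∂circleHaar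
      - ⟪∫ z, h z ∂circleHaar, B (∫ z, α z ∂circleHaar) (∫ z, g z ∂circleHaar)⟫_ℂ‖
      + potential (64 * (1 - ‖∫ z, f z ∂circleHaar‖ ^ 2) - ‖(∫ z, α z ∂circleHaar) + v‖ ^ 2)
        (∫ z, g z ∂circleHaar) (∫ z, h z ∂circleHaar)
    ≤ ∫ z, potential (64 * (1 - ‖f z‖ ^ 2) - ‖α z‖ ^ 2) (g z) (h z) ∂circleHaar := by
  have hα8 : ∀ z, ‖α z‖ ≤ 8 := fun z => by
    have := hαf z
    nlinarith [sq_nonneg ‖f z‖, norm_nonneg (α z)]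
  have hcross := norm_integral_trilinear_sub_le B hB hg hh hα hα8
  have hvar := integral_norm_sub_mean_sq hα
  set A : Circle → ℝ := fun z => 64 * (1 - ‖f z‖ ^ 2) - ‖α z‖ ^ 2 with hAdef
  have hA : Continuous A := by fun_prop
  have hA0 : ∀ z, 0 ≤ A z := fun z => sub_nonneg.mpr (hαf z)
  have hAint : ∫ z, A z ∂circleHaar
      = 64 * (1 - ∫ z, ‖f z‖ ^ 2 ∂circleHaar) - ∫ z, ‖α z‖ ^ 2 ∂circleHaar := by
    simp only [hAdef]
    rw [integral_sub, integral_const_mul, integral_sub]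
    · simp
    all_goals exact Continuous.integrable_circleHaar (by fun_prop)
  have hAint0 : 0 ≤ ∫ z, A z ∂circleHaar := integral_nonneg hA0
  set q := ∫ z, ‖α z - ∫ w, α w ∂circleHaar‖ ^ 2 ∂circleHaar with hq
  have hq0 : 0 ≤ q := integral_nonneg fun z => by positivity
  set a := 1 + (64 * (1 - ‖∫ z, f z ∂circleHaar‖ ^ 2) - ‖(∫ z, α z ∂circleHaar) + v‖ ^ 2) with ha
  have haq : 1 + ∫ z, A z ∂circleHaar ≤ a - q := by
    rw [ha, hAint, hαv, hvar]; linarith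
  have ha1 : 1 ≤ a := by linarith
  have ha65 : a ≤ 65 := by
    rw [ha]; nlinarith [sq_nonneg ‖∫ z, f z ∂circleHaar‖, sq_nonneg ‖(∫ z, α z ∂circleHaar) + v‖]
  have hwg := weighted_mean_le hg hA hA0 ha1 ha65 hq0 haq
  have hwh := weighted_mean_le hh hA hA0 ha1 ha65 hq0 haq
  have hcont : Continuous fun z => 7 + 4225 / (1 + A z) :=
    continuous_const.add (continuous_const.div (by fun_prop) fun z => by
      have := hA0 z; positivity)
  have hsplit : ∫ z, potential (A z) (g z) (h z) ∂circleHaar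
      = ∫ z, ‖g z‖ ^ 2 * (7 + 4225 / (1 + A z)) ∂circleHaar
        + ∫ z, ‖h z‖ ^ 2 * (7 + 4225 / (1 + A z)) ∂circleHaar := by
    simp only [potential, add_mul]
    exact integral_add (Continuous.integrable_circleHaar (by fun_prop))
      (Continuous.integrable_circleHaar (by fun_prop))
  rw [hsplit, potential, ← ha, add_mul]
  linarith

end MeanEstimates

section Averaging

variable {E : Type*} [NormedAddCommGroup E] [NormedSpace ℝ E] {b : Circle → Circle}

theorem continuous_circle_average {F : Circle → E} (hF : Continuous F) (hb : Continuous b) :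
    Continuous fun z => ∫ w, F (z * b w) ∂circleHaar := by
  have h := continuous_parametric_integral_of_continuous (μ := circleHaar)
    (f := fun z w => F (z * b w)) (by fun_prop) (isCompact_univ (X := Circle))
  simpa using h

theorem integral_circle_average [CompleteSpace E] {F : Circle → E} (hF : Continuous F)
    (hb : Continuous b) :
    ∫ z, ∫ w, F (z * b w) ∂circleHaar ∂circleHaar = ∫ z, F z ∂circleHaar := by
  rw [integral_integral_swap]
  · have h : ∀ w, ∫ z, F (z * b w) ∂circleHaar = ∫ z, F z ∂circleHaar := fun w => by
      simp only [mul_comm _ (b w)]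
      exact integral_mul_left_eq_self F _
    simp [h]
  · refine Continuous.integrable_of_hasCompactSupport ?_ (HasCompactSupport.of_compactSpace _)
    fun_prop

end Averaging

/-- The radii of the circles on which the telescoping estimate is run. -/
noncomputable def rad (k : ℕ) : ℝ := 1 - 1 / 2 ^ (k + 1)

theorem rad_pos (k : ℕ) : 0 < rad k := by
  have : (1 : ℝ) < 2 ^ (k + 1) := one_lt_pow₀ (by norm_num) (by omega)
  unfold rad
  rw [sub_pos, div_lt_one (by positivity)]
  exact this

theorem rad_lt_one (k : ℕ) : rad k < 1 := by
  unfold rad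
  have : (0 : ℝ) < 1 / 2 ^ (k + 1) := by positivity
  linarith

theorem rad_lt_rad_succ (k : ℕ) : rad k < rad (k + 1) := by
  unfold rad
  have : (1 : ℝ) / 2 ^ (k + 1 + 1) < 1 / 2 ^ (k + 1) :=
    one_div_lt_one_div_of_lt (by positivity) (pow_lt_pow_right₀ (by norm_num) (by omega))
  linarith

theorem quarter_le_rad_pow (k : ℕ) : 1 / 4 ≤ rad k ^ (2 ^ (k + 1) - 1) := by
  have h1 : 1 / 2 ≤ rad k ^ 2 ^ k := by
    have h := one_add_mul_le_pow (a := -(1 / 2 ^ (k + 1) : ℝ)) (by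
      have := rad_pos k; unfold rad at this; linarith) (2 ^ k)
    have e : (1 : ℝ) + ((2 ^ k : ℕ) : ℝ) * -(1 / 2 ^ (k + 1)) = 1 / 2 := by
      push_cast; rw [pow_succ]; field_simp; norm_num
    rw [e, ← sub_eq_add_neg] at h
    exact h
  calc (1 / 4 : ℝ) = (1 / 2) ^ 2 := by norm_num
    _ ≤ (rad k ^ 2 ^ k) ^ 2 := by gcongr
    _ = rad k ^ 2 ^ (k + 1) := by rw [← pow_mul, pow_succ]
    _ ≤ rad k ^ (2 ^ (k + 1) - 1) :=
      pow_le_pow_of_le_one (rad_pos k).le (rad_lt_one k).le (Nat.sub_le _ _)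

theorem rad_sq_gap (k : ℕ) : 1 / (2 * 2 ^ (k + 1)) ≤ rad (k + 1) ^ 2 - rad k ^ 2 := by
  have h : (2 : ℝ) ≤ 2 ^ (k + 1) := by
    calc (2 : ℝ) = 2 ^ 1 := by norm_num
      _ ≤ 2 ^ (k + 1) := pow_le_pow_right₀ (by norm_num) (by omega)
  unfold rad
  rw [pow_succ 2 (k + 1)]
  set n : ℝ := 2 ^ (k + 1)
  have hn : 0 < n := by linarith
  have : (1 - 1 / (n * 2)) ^ 2 - (1 - 1 / n) ^ 2 - 1 / (2 * n) = (2 * n - 3) / (4 * n ^ 2) := by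
    field_simp; ring
  have h2 : 0 ≤ (2 * n - 3) / (4 * n ^ 2) := by
    apply div_nonneg <;> nlinarith
  linarith

/-- The `k`-th coordinate of the vector field appearing in the telescoping estimate. -/
noncomputable def shadow (f : Polynomial ℂ) (k : ℕ) (z : Circle) : ℂ :=
  ((2 ^ (k + 1) * rad k ^ (2 ^ (k + 1) - 1) : ℝ) : ℂ)⁻¹ * conj (z : ℂ) ^ (2 ^ (k + 1) - 1)
    * f.derivative.eval (rad k * z : ℂ)

@[fun_prop]
theorem continuous_shadow (f : Polynomial ℂ) (k : ℕ) : Continuous (shadow f k) := by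
  unfold shadow
  have h1 : Continuous fun z : Circle => conj (z : ℂ) :=
    Complex.continuous_conj.comp Circle.continuous_coe
  have h2 : Continuous fun z : Circle => f.derivative.eval (rad k * z : ℂ) :=
    f.derivative.continuous.comp (by fun_prop)
  fun_prop

theorem norm_shadow_sq_le (f : Polynomial ℂ) (k : ℕ) {b : Circle → Circle} (hbc : Continuous b)
    (hb : ∀ z : Circle, (b z : ℂ) * (1 + (rad k / rad (k + 1) : ℝ) * z)
      = (rad k / rad (k + 1) : ℝ) + z) (z : Circle) :
    ‖shadow f k z‖ ^ 2 ≤ 64 * (∫ w, ‖f.eval (rad (k + 1) * (z * b w : Circle) : ℂ)‖ ^ 2 ∂circleHaar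
      - ‖∫ w, f.eval (rad (k + 1) * (z * b w : Circle) : ℂ) ∂circleHaar‖ ^ 2) := by
  have hr' := rad_pos (k + 1)
  have h0 : 0 ≤ rad k / rad (k + 1) := div_nonneg (rad_pos k).le hr'.le
  have h1 : rad k / rad (k + 1) < 1 := (div_lt_one hr').mpr (rad_lt_rad_succ k)
  set F : Circle → ℂ := fun w => f.eval (rad (k + 1) * (z * b w : Circle) : ℂ) with hF
  have hFc : Continuous F := f.continuous.comp (by fun_prop)
  rw [← integral_norm_sub_mean_sq hFc]
  set m := ∫ w, F w ∂circleHaar with hm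
  have hcc : Continuous fun z : Circle => conj (z : ℂ) :=
    Complex.continuous_conj.comp Circle.continuous_coe
  have hgrad : ∫ w : Circle, conj (w : ℂ) * (F w - m) ∂circleHaar
      = f.derivative.eval (rad k * z : ℂ) * z
        * ((rad (k + 1) ^ 2 - rad k ^ 2) / rad (k + 1) : ℝ) := by
    have e := integral_conj_mul_eval_blaschke h0 h1 hbc hb f (rad (k + 1) * z)
    have hne : (rad (k + 1) : ℂ) ≠ 0 := by exact_mod_cast hr'.ne'
    have e1 : (rad (k + 1) * z * ((rad k / rad (k + 1) : ℝ) : ℂ) : ℂ) = rad k * z := by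
      push_cast; field_simp
    rw [e1] at e
    simp only [mul_sub]
    rw [integral_sub, integral_mul_const]
    · have hz := integral_circle_conj_pow_mul_pow 1 0
      simp only [pow_one, pow_zero, mul_one, one_ne_zero, if_false] at hz
      rw [hz, zero_mul, sub_zero]
      simp only [hF, Circle.coe_mul, ← mul_assoc]
      rw [e]
      push_cast
      field_simp
    all_goals exact Continuous.integrable_circleHaar (by fun_prop)
  have hcs : ‖∫ w : Circle, conj (w : ℂ) * (F w - m) ∂circleHaar‖ ^ 2
      ≤ ∫ w, ‖F w - m‖ ^ 2 ∂circleHaar := by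
    have := integral_norm_sub_mean_sq (F := fun w : Circle => conj (w : ℂ) * (F w - m))
      (by fun_prop)
    have h2 : 0 ≤ ∫ w : Circle, ‖conj (w : ℂ) * (F w - m)
      - ∫ w : Circle, conj (w : ℂ) * (F w - m) ∂circleHaar‖ ^ 2 ∂circleHaar :=
      integral_nonneg fun w => by positivity
    have h3 : ∀ w : Circle, ‖conj (w : ℂ) * (F w - m)‖ = ‖F w - m‖ := fun w => by
      simp [Circle.norm_coe]
    simp only [h3] at this
    linarith
  rw [hgrad] at hcs
  refine le_trans ?_ (mul_le_mul_of_nonneg_left hcs (by norm_num))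
  have hgap := rad_sq_gap k
  have hq := quarter_le_rad_pow k
  have hgap0 : (0 : ℝ) < 1 / (2 * 2 ^ (k + 1)) := by positivity
  have hgap' : 1 / (2 * 2 ^ (k + 1)) ≤ (rad (k + 1) ^ 2 - rad k ^ 2) / rad (k + 1) := by
    refine hgap.trans ?_
    rw [le_div_iff₀ hr']
    nlinarith [rad_lt_one (k + 1)]
  have hs : ‖shadow f k z‖
      = (2 ^ (k + 1) * rad k ^ (2 ^ (k + 1) - 1))⁻¹ * ‖f.derivative.eval (rad k * z : ℂ)‖ := by
    have : 0 ≤ (2 ^ (k + 1) * rad k ^ (2 ^ (k + 1) - 1) : ℝ) := by positivity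
    simp only [shadow, norm_mul, norm_inv, Complex.norm_real, Real.norm_of_nonneg this, norm_pow,
      RCLike.norm_conj, Circle.norm_coe, one_pow, mul_one]
  have hd : ‖(f.derivative.eval (rad k * z : ℂ) * z
      * ((rad (k + 1) ^ 2 - rad k ^ 2) / rad (k + 1) : ℝ) : ℂ)‖
      = ‖f.derivative.eval (rad k * z : ℂ)‖ * ((rad (k + 1) ^ 2 - rad k ^ 2) / rad (k + 1)) := by
    rw [norm_mul, norm_mul, Circle.norm_coe, mul_one, Complex.norm_real,
      Real.norm_of_nonneg (hgap0.le.trans hgap')]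
  rw [hs, hd, show (64 : ℝ) = 8 ^ 2 by norm_num, ← mul_pow]
  gcongr ?_ ^ 2
  calc (2 ^ (k + 1) * rad k ^ (2 ^ (k + 1) - 1))⁻¹ * ‖f.derivative.eval (rad k * z : ℂ)‖
      ≤ (2 ^ (k + 1) * (1 / 4))⁻¹ * ‖f.derivative.eval (rad k * z : ℂ)‖ := by gcongr
    _ = 8 * (‖f.derivative.eval (rad k * z : ℂ)‖ * (1 / (2 * 2 ^ (k + 1)))) := by
      field_simp; ring
    _ ≤ _ := by gcongr

theorem Continuous.potential {A : Circle → ℝ} {H : Type*} [NormedAddCommGroup H]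
    {g h : Circle → H} (hA : Continuous A)
    (hg : Continuous g) (hh : Continuous h) (hA0 : ∀ z, 0 ≤ A z) :
    Continuous fun z => potential (A z) (g z) (h z) := by
  have : Continuous fun z => 7 + 4225 / (1 + A z) :=
    continuous_const.add (continuous_const.div (by fun_prop) fun z => by
      have := hA0 z; positivity)
  unfold _root_.potential
  fun_prop

section Telescoping

variable {H : Type*} [NormedAddCommGroup H] [InnerProductSpace ℂ H]

/-- The operator-valued linear map `v ↦ ∑ k, v k • U k`. -/
noncomputable def linComb (U : ℕ → H →L[ℂ] H) (N : ℕ) : EuclideanSpace ℂ (Fin N) →L[ℂ] H →L[ℂ] H :=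
  ∑ k : Fin N, (EuclideanSpace.proj k : EuclideanSpace ℂ (Fin N) →L[ℂ] ℂ).smulRight (U k)

theorem linComb_apply (U : ℕ → H →L[ℂ] H) (N : ℕ) (v : EuclideanSpace ℂ (Fin N)) :
    linComb U N v = ∑ k : Fin N, v k • U k := by
  simp [linComb]

/-- The `k`-th term of the bilinear form in the telescoping estimate. -/
noncomputable def hankelTerm (U : ℕ → H →L[ℂ] H) (x y : ℕ → H) (D : ℕ) (f : Polynomial ℂ) (k : ℕ) :
    ℂ :=
  ∫ z : Circle, shadow f k z *
    ⟪vecPoly y D (conj (rad k * z : ℂ)), U k (vecPoly x D (rad k * z : ℂ))⟫_ℂ ∂circleHaar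

theorem continuous_vecPoly_conj (y : ℕ → H) (D : ℕ) (r : ℝ) :
    Continuous fun z : Circle => vecPoly y D (conj (r * z : ℂ)) := by
  have := Complex.continuous_conj.comp (f := fun z : Circle => (r * z : ℂ)) (by fun_prop)
  exact (continuous_vecPoly y D).comp this

theorem exists_field_telescope [CompleteSpace H] {U : ℕ → H →L[ℂ] H} {N : ℕ}
    (hU : ∀ v x, ‖linComb U N v x‖ ≤ 3 / 2 * ‖v‖ * ‖x‖) (x y : ℕ → H) (D : ℕ)
    {f : Polynomial ℂ} (hf : ∀ z : ℂ, ‖z‖ ≤ 1 → ‖f.eval z‖ ≤ 1) (m : ℕ) :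
    ∀ i, i + m = N → ∃ α : Circle → EuclideanSpace ℂ (Fin N), Continuous α ∧
      (∀ z (k : Fin N), (k : ℕ) < i → α z k = 0) ∧
      (∀ z, ‖α z‖ ^ 2 ≤ 64 * (1 - ‖f.eval (rad i * z : ℂ)‖ ^ 2)) ∧
      ‖∫ z : Circle, ⟪vecPoly y D (conj (rad i * z : ℂ)),
          linComb U N (α z) (vecPoly x D (rad i * z : ℂ))⟫_ℂ ∂circleHaar
        - ∑ k ∈ Finset.Ico i N, hankelTerm U x y D f k‖
        + ∫ z : Circle, potential (64 * (1 - ‖f.eval (rad i * z : ℂ)‖ ^ 2) - ‖α z‖ ^ 2)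
            (vecPoly x D (rad i * z : ℂ)) (vecPoly y D (conj (rad i * z : ℂ))) ∂circleHaar
      ≤ ∫ z : Circle, potential (64 * (1 - ‖f.eval (rad N * z : ℂ)‖ ^ 2))
            (vecPoly x D (rad N * z : ℂ)) (vecPoly y D (conj (rad N * z : ℂ))) ∂circleHaar := by
  have hfle : ∀ i (z : Circle), ‖f.eval (rad i * z : ℂ)‖ ≤ 1 := fun i z => hf _ (by
    rw [norm_mul, Complex.norm_real, Real.norm_of_nonneg (rad_pos i).le, Circle.norm_coe, mul_one]
    exact (rad_lt_one i).le)
  have hfc : ∀ i, Continuous fun z : Circle => f.eval (rad i * z : ℂ) :=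
    fun i => f.continuous.comp (by fun_prop)
  have hxc : ∀ i, Continuous fun z : Circle => vecPoly x D (rad i * z : ℂ) := fun i => by fun_prop
  have hyc := fun i => continuous_vecPoly_conj y D (rad i)
  induction m with
  | zero =>
    rintro i rfl
    refine ⟨0, continuous_const, by simp, fun z => ?_, by simp⟩
    have := hfle i z
    have h0 := norm_nonneg (f.eval (rad i * z : ℂ))
    simp only [Pi.zero_apply, norm_zero]
    nlinarith
  | succ m ih =>
    intro i hi
    obtain ⟨α, hαc, hαz, hαf, hα⟩ := ih (i + 1) (by omega)
    have h0 : 0 ≤ rad i / rad (i + 1) := div_nonneg (rad_pos i).le (rad_pos (i + 1)).le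
    have h1 : rad i / rad (i + 1) < 1 := (div_lt_one (rad_pos (i + 1))).mpr (rad_lt_rad_succ i)
    obtain ⟨b, hbc, hb⟩ := exists_blaschke h0 h1
    have hne : (rad (i + 1) : ℂ) ≠ 0 := by exact_mod_cast (rad_pos (i + 1)).ne'
    have hrad : ∀ z : Circle,
        (rad (i + 1) * z * ((rad i / rad (i + 1) : ℝ) : ℂ) : ℂ) = rad i * z := by
      intro z; push_cast; field_simp
    have hfm : ∀ z : Circle, ∫ w, f.eval (rad (i + 1) * (z * b w : Circle) : ℂ) ∂circleHaar
        = f.eval (rad i * z : ℂ) := fun z => by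
      simp only [Circle.coe_mul, ← mul_assoc]
      rw [integral_eval_blaschke h0 h1 hbc hb, hrad]
    have hxm : ∀ z : Circle, ∫ w, vecPoly x D (rad (i + 1) * (z * b w : Circle) : ℂ) ∂circleHaar
        = vecPoly x D (rad i * z : ℂ) := fun z => by
      simp only [Circle.coe_mul, ← mul_assoc]
      rw [integral_vecPoly_comp (by fun_prop) _ (integral_mul_blaschke_pow h0 h1 hbc hb _), hrad]
    have hym : ∀ z : Circle,
        ∫ w, vecPoly y D (conj (rad (i + 1) * (z * b w : Circle) : ℂ)) ∂circleHaar
        = vecPoly y D (conj (rad i * z : ℂ)) := fun z => by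
      simp only [Circle.coe_mul, ← mul_assoc]
      rw [integral_vecPoly_comp (φ := fun w => conj (rad (i + 1) * z * b w : ℂ))
        (Complex.continuous_conj.comp (by fun_prop)) _
        (integral_conj_mul_blaschke_pow' h0 h1 hbc hb _), hrad]
    have hiN : i < N := by omega
    set e : EuclideanSpace ℂ (Fin N) := EuclideanSpace.single ⟨i, hiN⟩ 1 with he
    set α' : Circle → EuclideanSpace ℂ (Fin N) := fun z => ∫ w, α (z * b w) ∂circleHaar with hα'
    have hα'c : Continuous α' := continuous_circle_average hαc hbc
    have hα'z : ∀ z (k : Fin N), (k : ℕ) < i + 1 → α' z k = 0 := by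
      intro z k hk
      have := (EuclideanSpace.proj k : EuclideanSpace ℂ (Fin N) →L[ℂ] ℂ).integral_comp_comm
        (μ := circleHaar) (φ := fun w => α (z * b w))
        (Continuous.integrable_circleHaar (by fun_prop))
      have h0 : ∀ w, (EuclideanSpace.proj k : EuclideanSpace ℂ (Fin N) →L[ℂ] ℂ) (α (z * b w)) = 0 :=
        fun w => hαz _ k hk
      simp only [h0, integral_zero] at this
      exact this.symm
    have hnorm : ∀ z, ‖α' z + shadow f i z • e‖ ^ 2 = ‖α' z‖ ^ 2 + ‖shadow f i z • e‖ ^ 2 := by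
      intro z
      have : ⟪α' z, shadow f i z • e⟫_ℂ = 0 := by
        rw [inner_smul_right, he, EuclideanSpace.inner_single_right, hα'z z _ (by simp)]
        simp
      have h := norm_add_sq_eq_norm_sq_add_norm_sq_of_inner_eq_zero _ _ this
      simpa only [sq] using h
    have hen : ∀ z, ‖shadow f i z • e‖ = ‖shadow f i z‖ := fun z => by
      rw [norm_smul, he]; simp
    have hsh : ∀ z, ‖shadow f i z • e‖ ^ 2
        ≤ 64 * (∫ w, ‖f.eval (rad (i + 1) * (z * b w : Circle) : ℂ)‖ ^ 2 ∂circleHaar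
          - ‖∫ w, f.eval (rad (i + 1) * (z * b w : Circle) : ℂ) ∂circleHaar‖ ^ 2) := fun z => by
      rw [hen]; exact norm_shadow_sq_le f i hbc hb z
    have hstep := fun z => potential_step (linComb U N) hU
      (g := fun w => vecPoly x D (rad (i + 1) * (z * b w : Circle) : ℂ))
      (h := fun w => vecPoly y D (conj (rad (i + 1) * (z * b w : Circle) : ℂ)))
      (α := fun w => α (z * b w)) (f := fun w => f.eval (rad (i + 1) * (z * b w : Circle) : ℂ))
      (by fun_prop) ((hyc (i + 1)).comp (by fun_prop : Continuous fun w => z * b w)) (by fun_prop)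
      ((hfc (i + 1)).comp (by fun_prop : Continuous fun w => z * b w))
      (fun w => hαf _) (hnorm z) (hsh z)
    simp only [hfm, hxm, hym] at hstep hsh
    have hbz : ∀ z, ‖α' z + shadow f i z • e‖ ^ 2 ≤ 64 * (1 - ‖f.eval (rad i * z : ℂ)‖ ^ 2) := by
      intro z
      have hvar := integral_norm_sub_mean_sq (F := fun w => α (z * b w)) (by fun_prop)
      have hvar0 : 0 ≤ ∫ w, ‖α (z * b w) - ∫ w, α (z * b w) ∂circleHaar‖ ^ 2 ∂circleHaar :=
        integral_nonneg fun w => by positivity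
      have hfbc : Continuous fun w => f.eval (rad (i + 1) * (z * b w : Circle) : ℂ) :=
        (hfc (i + 1)).comp (by fun_prop : Continuous fun w => z * b w)
      have hmono : ∫ w, ‖α (z * b w)‖ ^ 2 ∂circleHaar
          ≤ ∫ w, 64 * (1 - ‖f.eval (rad (i + 1) * (z * b w : Circle) : ℂ)‖ ^ 2) ∂circleHaar :=
        integral_mono (Continuous.integrable_circleHaar (by fun_prop))
          (Continuous.integrable_circleHaar (by fun_prop)) fun w => hαf _
      rw [integral_const_mul, integral_sub (integrable_const _)
        (Continuous.integrable_circleHaar (by fun_prop))] at hmono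
      simp only [integral_const, probReal_univ, one_smul] at hmono
      rw [hnorm z]
      linarith [hsh z]
    have hβc : Continuous fun z => α' z + shadow f i z • e := by fun_prop
    refine ⟨fun z => α' z + shadow f i z • e, hβc, ?_, hbz, ?_⟩
    · intro z k hk
      have hki : k ≠ ⟨i, hiN⟩ := fun h => by simp [h] at hk
      simp [hα'z z k (by omega), he, hki]
    have hΨ : Continuous fun z : Circle => ⟪vecPoly y D (conj (rad (i + 1) * z : ℂ)),
        linComb U N (α z) (vecPoly x D (rad (i + 1) * z : ℂ))⟫_ℂ := by
      have := hyc (i + 1)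
      fun_prop
    have hPot : Continuous fun z : Circle =>
        potential (64 * (1 - ‖f.eval (rad (i + 1) * z : ℂ)‖ ^ 2) - ‖α z‖ ^ 2)
          (vecPoly x D (rad (i + 1) * z : ℂ)) (vecPoly y D (conj (rad (i + 1) * z : ℂ))) := by
      have := hfc (i + 1)
      exact Continuous.potential (by fun_prop) (hxc _) (hyc _) fun z => sub_nonneg.mpr (hαf z)
    have hPot' : Continuous fun z : Circle =>
        potential (64 * (1 - ‖f.eval (rad i * z : ℂ)‖ ^ 2) - ‖α' z + shadow f i z • e‖ ^ 2)
          (vecPoly x D (rad i * z : ℂ)) (vecPoly y D (conj (rad i * z : ℂ))) := by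
      have := hfc i
      exact Continuous.potential (by fun_prop) (hxc _) (hyc _) fun z => sub_nonneg.mpr (hbz z)
    have hΨ' : Continuous fun z : Circle => ⟪vecPoly y D (conj (rad i * z : ℂ)),
        linComb U N (α' z) (vecPoly x D (rad i * z : ℂ))⟫_ℂ := by
      have := hyc i
      fun_prop
    have hT : Continuous fun z : Circle => shadow f i z *
        ⟪vecPoly y D (conj (rad i * z : ℂ)), U i (vecPoly x D (rad i * z : ℂ))⟫_ℂ := by
      have := hyc i
      fun_prop
    have hform : ∫ z : Circle, ⟪vecPoly y D (conj (rad i * z : ℂ)),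
          linComb U N (α' z + shadow f i z • e) (vecPoly x D (rad i * z : ℂ))⟫_ℂ ∂circleHaar
        = ∫ z : Circle, ⟪vecPoly y D (conj (rad i * z : ℂ)),
          linComb U N (α' z) (vecPoly x D (rad i * z : ℂ))⟫_ℂ ∂circleHaar
          + hankelTerm U x y D f i := by
      rw [hankelTerm, ← integral_add hΨ'.integrable_circleHaar hT.integrable_circleHaar]
      congr 1
      ext z
      have hBe : linComb U N e = U i := by
        rw [linComb_apply, Finset.sum_eq_single ⟨i, hiN⟩] <;> simp +contextual [he]
      rw [map_add, map_smul, hBe]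
      simp
    have hint := integral_mono (μ := circleHaar)
      (((continuous_circle_average hΨ hbc).sub hΨ').norm.add hPot').integrable_circleHaar
      (continuous_circle_average hPot hbc).integrable_circleHaar hstep
    rw [integral_circle_average hPot hbc] at hint
    simp only [Pi.add_apply] at hint
    rw [integral_add
      ((continuous_circle_average hΨ hbc).sub hΨ').norm.integrable_circleHaar
      hPot'.integrable_circleHaar] at hint
    simp only [Pi.sub_apply] at hint
    beta_reduce
    have hle := norm_integral_le_integral_norm (μ := circleHaar) (fun z : Circle =>
      (∫ w, ⟪vecPoly y D (conj (rad (i + 1) * (z * b w : Circle) : ℂ)),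
        linComb U N (α (z * b w)) (vecPoly x D (rad (i + 1) * (z * b w : Circle) : ℂ))⟫_ℂ
          ∂circleHaar)
      - ⟪vecPoly y D (conj (rad i * z : ℂ)),
        linComb U N (α' z) (vecPoly x D (rad i * z : ℂ))⟫_ℂ)
    rw [integral_sub (continuous_circle_average hΨ hbc).integrable_circleHaar
      hΨ'.integrable_circleHaar, integral_circle_average hΨ hbc] at hle
    rw [hform, Finset.sum_eq_sum_Ico_succ_bot hiN]
    set S := ∑ k ∈ Finset.Ico (i + 1) N, hankelTerm U x y D f k
    set P := ∫ z : Circle, ⟪vecPoly y D (conj (rad i * z : ℂ)),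
      linComb U N (α' z) (vecPoly x D (rad i * z : ℂ))⟫_ℂ ∂circleHaar
    set Q := ∫ z : Circle, ⟪vecPoly y D (conj (rad (i + 1) * z : ℂ)),
      linComb U N (α z) (vecPoly x D (rad (i + 1) * z : ℂ))⟫_ℂ ∂circleHaar
    have htri : ‖P + hankelTerm U x y D f i - (hankelTerm U x y D f i + S)‖
        ≤ ‖Q - P‖ + ‖Q - S‖ := by
      rw [show P + hankelTerm U x y D f i - (hankelTerm U x y D f i + S)
        = (Q - S) - (Q - P) by ring]
      exact (norm_sub_le _ _).trans (add_comm _ _).le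
    linarith

theorem norm_sum_hankelTerm_le [CompleteSpace H] {U : ℕ → H →L[ℂ] H} {N : ℕ}
    (hU : ∀ v x, ‖linComb U N v x‖ ≤ 3 / 2 * ‖v‖ * ‖x‖) (x y : ℕ → H) (D : ℕ)
    {f : Polynomial ℂ} (hf : ∀ z : ℂ, ‖z‖ ≤ 1 → ‖f.eval z‖ ≤ 1) :
    ‖∑ k ∈ Finset.range N, hankelTerm U x y D f k‖
      ≤ 4232 * (∑ j ∈ Finset.range D, ‖x j‖ ^ 2 + ∑ j ∈ Finset.range D, ‖y j‖ ^ 2) := by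
  obtain ⟨α, hαc, -, hαf, hα⟩ := exists_field_telescope hU x y D hf N 0 (by simp)
  have hfc : ∀ i, Continuous fun z : Circle => f.eval (rad i * z : ℂ) :=
    fun i => f.continuous.comp (by fun_prop)
  have hxc : ∀ i, Continuous fun z : Circle => vecPoly x D (rad i * z : ℂ) := fun i => by fun_prop
  have hyc := fun i => continuous_vecPoly_conj y D (rad i)
  have hfle : ∀ i (z : Circle), ‖f.eval (rad i * z : ℂ)‖ ≤ 1 := fun i z => hf _ (by
    rw [norm_mul, Complex.norm_real, Real.norm_of_nonneg (rad_pos i).le, Circle.norm_coe, mul_one]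
    exact (rad_lt_one i).le)
  have hA : ∀ i (z : Circle), 0 ≤ 64 * (1 - ‖f.eval (rad i * z : ℂ)‖ ^ 2) := fun i z => by
    have := hfle i z
    have h0 := norm_nonneg (f.eval (rad i * z : ℂ))
    nlinarith
  have hfirst : ‖∫ z : Circle, ⟪vecPoly y D (conj (rad 0 * z : ℂ)),
      linComb U N (α z) (vecPoly x D (rad 0 * z : ℂ))⟫_ℂ ∂circleHaar‖
      ≤ ∫ z : Circle, potential (64 * (1 - ‖f.eval (rad 0 * z : ℂ)‖ ^ 2) - ‖α z‖ ^ 2)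
            (vecPoly x D (rad 0 * z : ℂ)) (vecPoly y D (conj (rad 0 * z : ℂ))) ∂circleHaar := by
    refine norm_integral_le_of_norm_le (Continuous.integrable_circleHaar ?_)
      (.of_forall fun z => ?_)
    · have := hfc 0
      exact Continuous.potential (by fun_prop) (hxc _) (hyc _) fun z => sub_nonneg.mpr (hαf z)
    · have h8 : ‖α z‖ ≤ 8 := by
        have := hαf z
        nlinarith [sq_nonneg ‖f.eval (rad 0 * z : ℂ)‖, norm_nonneg (α z)]
      have hA0 := sub_nonneg.mpr (hαf z)
      unfold potential
      set u := vecPoly x D (rad 0 * z : ℂ)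
      set v := vecPoly y D (conj (rad 0 * z : ℂ))
      have h1 : ‖⟪v, linComb U N (α z) u⟫_ℂ‖ ≤ ‖v‖ * (3 / 2 * 8 * ‖u‖) :=
        (norm_inner_le_norm _ _).trans (by gcongr; exact (hU _ _).trans (by gcongr))
      have h2 : 7 ≤ 7 + 4225 / (1 + (64 * (1 - ‖f.eval (rad 0 * z : ℂ)‖ ^ 2) - ‖α z‖ ^ 2)) :=
        le_add_of_nonneg_right (by positivity)
      have h3 : (‖u‖ ^ 2 + ‖v‖ ^ 2) * 7 ≤ (‖u‖ ^ 2 + ‖v‖ ^ 2)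
          * (7 + 4225 / (1 + (64 * (1 - ‖f.eval (rad 0 * z : ℂ)‖ ^ 2) - ‖α z‖ ^ 2))) := by
        gcongr
      nlinarith [sq_nonneg (‖u‖ - ‖v‖), sq_nonneg ‖u‖, sq_nonneg ‖v‖]
  have hlast : ∫ z : Circle, potential (64 * (1 - ‖f.eval (rad N * z : ℂ)‖ ^ 2))
      (vecPoly x D (rad N * z : ℂ)) (vecPoly y D (conj (rad N * z : ℂ))) ∂circleHaar
      ≤ 4232 * (∑ j ∈ Finset.range D, ‖x j‖ ^ 2 + ∑ j ∈ Finset.range D, ‖y j‖ ^ 2) := by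
    have h1 : ∫ z : Circle, potential (64 * (1 - ‖f.eval (rad N * z : ℂ)‖ ^ 2))
        (vecPoly x D (rad N * z : ℂ)) (vecPoly y D (conj (rad N * z : ℂ))) ∂circleHaar
        ≤ ∫ z : Circle, 4232 * (‖vecPoly x D (rad N * z : ℂ)‖ ^ 2
          + ‖vecPoly y D (conj (rad N * z : ℂ))‖ ^ 2) ∂circleHaar := by
      have hf' := hfc N
      have hy' := hyc N
      refine integral_mono
        (Continuous.potential (by fun_prop) (hxc _) (hyc _) (hA N)).integrable_circleHaar
        (Continuous.integrable_circleHaar (by fun_prop)) fun z => ?_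
      have hd : 4225 / (1 + 64 * (1 - ‖f.eval (rad N * z : ℂ)‖ ^ 2)) ≤ 4225 :=
        div_le_self (by norm_num) (by linarith [hA N z])
      simp only [potential]
      rw [mul_comm 4232]
      gcongr
      linarith
    refine h1.trans ?_
    have hy' := hyc N
    rw [integral_const_mul, integral_add (Continuous.integrable_circleHaar (by fun_prop))
      (Continuous.integrable_circleHaar (by fun_prop)), integral_norm_sq_vecPoly,
      integral_norm_sq_vecPoly_conj]
    have hr : ∀ j : ℕ, rad N ^ (2 * j) ≤ 1 := fun j => pow_le_one₀ (rad_pos N).le (rad_lt_one N).le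
    have hs : ∀ w : ℕ → H, ∑ j ∈ Finset.range D, rad N ^ (2 * j) * ‖w j‖ ^ 2
        ≤ ∑ j ∈ Finset.range D, ‖w j‖ ^ 2 := fun w =>
      Finset.sum_le_sum fun j _ => mul_le_of_le_one_left (by positivity) (hr j)
    linarith [hs x, hs y]
  rw [← Finset.range_eq_Ico] at hα
  set S := ∑ k ∈ Finset.range N, hankelTerm U x y D f k
  set P := ∫ z : Circle, ⟪vecPoly y D (conj (rad 0 * z : ℂ)),
      linComb U N (α z) (vecPoly x D (rad 0 * z : ℂ))⟫_ℂ ∂circleHaar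
  have : ‖S‖ ≤ ‖P‖ + ‖P - S‖ := by
    rw [show S = P - (P - S) by ring]
    simpa using norm_sub_le P (P - S)
  linarith

theorem hankelTerm_eq (U : ℕ → H →L[ℂ] H) (x y : ℕ → H) (D : ℕ) (f : Polynomial ℂ) (k : ℕ) :
    hankelTerm U x y D f k = (2 ^ (k + 1) : ℂ)⁻¹ *
      ∑ m ∈ Finset.range (f.derivative.natDegree + 1), ∑ i ∈ Finset.range D,
        ∑ j ∈ Finset.range D, if m + i + j = 2 ^ (k + 1) - 1 then
          f.derivative.coeff m * ⟪y i, U k (x j)⟫_ℂ else 0 := by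
  set n := 2 ^ (k + 1) - 1 with hn
  set r := rad k with hr
  have hr0 : (r : ℂ) ≠ 0 := by exact_mod_cast (rad_pos k).ne'
  have hexp : ∀ z : Circle, shadow f k z *
      ⟪vecPoly y D (conj (r * z : ℂ)), U k (vecPoly x D (r * z : ℂ))⟫_ℂ
      = ∑ m ∈ Finset.range (f.derivative.natDegree + 1), ∑ i ∈ Finset.range D,
        ∑ j ∈ Finset.range D, ((2 ^ (k + 1) : ℂ)⁻¹ * ((r : ℂ) ^ n)⁻¹ * r ^ (m + i + j)
          * (f.derivative.coeff m * ⟪y i, U k (x j)⟫_ℂ))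
          * (conj (z : ℂ) ^ n * (z : ℂ) ^ (m + i + j)) := by
    intro z
    have hin : ⟪vecPoly y D (conj (r * z : ℂ)), U k (vecPoly x D (r * z : ℂ))⟫_ℂ
        = ∑ i ∈ Finset.range D, ∑ j ∈ Finset.range D,
          (r * z : ℂ) ^ (i + j) * ⟪y i, U k (x j)⟫_ℂ := by
      rw [vecPoly, sum_inner]
      refine Finset.sum_congr rfl fun i _ => ?_
      rw [vecPoly, map_sum, inner_sum]
      refine Finset.sum_congr rfl fun j _ => ?_
      rw [map_smul, inner_smul_left, inner_smul_right, map_pow, Complex.conj_conj]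
      ring
    rw [shadow, Polynomial.eval_eq_sum_range, ← hn, ← hr, Finset.mul_sum, Finset.sum_mul]
    refine Finset.sum_congr rfl fun m _ => ?_
    rw [hin, Finset.mul_sum]
    refine Finset.sum_congr rfl fun i _ => ?_
    rw [Finset.mul_sum]
    refine Finset.sum_congr rfl fun j _ => ?_
    push_cast
    rw [mul_inv]
    ring
  have hint : ∀ m i j : ℕ, Integrable (fun z : Circle =>
      ((2 ^ (k + 1) : ℂ)⁻¹ * ((r : ℂ) ^ n)⁻¹ * r ^ (m + i + j)
          * (f.derivative.coeff m * ⟪y i, U k (x j)⟫_ℂ))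
          * (conj (z : ℂ) ^ n * (z : ℂ) ^ (m + i + j))) circleHaar := fun m i j => by
    have h1 : Continuous fun z : Circle => conj (z : ℂ) :=
      Complex.continuous_conj.comp Circle.continuous_coe
    exact Continuous.integrable_circleHaar (by fun_prop)
  rw [hankelTerm]
  simp only [← hr, hexp]
  rw [integral_finsetSum _ fun m _ => integrable_finsetSum _ fun i _ =>
    integrable_finsetSum _ fun j _ => hint m i j, Finset.mul_sum]
  refine Finset.sum_congr rfl fun m _ => ?_
  rw [integral_finsetSum _ fun i _ => integrable_finsetSum _ fun j _ => hint m i j, Finset.mul_sum]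
  refine Finset.sum_congr rfl fun i _ => ?_
  rw [integral_finsetSum _ fun j _ => hint m i j, Finset.mul_sum]
  refine Finset.sum_congr rfl fun j _ => ?_
  rw [integral_const_mul, integral_circle_conj_pow_mul_pow]
  by_cases h : m + i + j = n
  · rw [if_pos h.symm, if_pos h, h]
    field_simp
  · rw [if_neg (Ne.symm h), if_neg h]; simp

end Telescoping

/-- The `ℓ²`-sum of copies of `E` indexed by `ι`. -/
abbrev EllTwo (ι E : Type*) [NormedAddCommGroup E] := lp (fun _ : ι => E) 2

section EllTwo

variable {ι κ E F : Type*} [NormedAddCommGroup E] [NormedAddCommGroup F]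

theorem EllTwo.sum_norm_sq_le (x : EllTwo ι E) (s : Finset ι) :
    ∑ i ∈ s, ‖x i‖ ^ 2 ≤ ‖x‖ ^ 2 := by
  simpa using lp.sum_rpow_le_norm_rpow (p := 2) (by simp) x s

variable [NormedSpace ℂ E] [NormedSpace ℂ F]

theorem sum_transfer_le {σ : κ → ι} {c : κ → E →L[ℂ] F} {K : ℝ} (hK : ∀ i, ‖c i‖ ≤ K)
    (hσ : Set.InjOn σ {i | c i ≠ 0}) (x : EllTwo ι E) (s : Finset κ) :
    ∑ i ∈ s, ‖c i (x (σ i))‖ ^ 2 ≤ (K * ‖x‖) ^ 2 := by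
  classical
  calc ∑ i ∈ s, ‖c i (x (σ i))‖ ^ 2
      = ∑ i ∈ s with c i ≠ 0, ‖c i (x (σ i))‖ ^ 2 := by
        refine (Finset.sum_filter_of_ne (p := fun i => c i ≠ 0) fun i _ h h0 => h ?_).symm
        simp [h0]
    _ ≤ ∑ i ∈ s with c i ≠ 0, K ^ 2 * ‖x (σ i)‖ ^ 2 := by
        refine Finset.sum_le_sum fun i _ => ?_
        rw [← mul_pow]
        gcongr
        exact (c i).le_of_opNorm_le (hK i) _
    _ = K ^ 2 * ∑ j ∈ {i ∈ s | c i ≠ 0}.image σ, ‖x j‖ ^ 2 := by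
        rw [← Finset.mul_sum, Finset.sum_image]
        exact hσ.mono fun i hi => (Finset.mem_filter.1 hi).2
    _ ≤ (K * ‖x‖) ^ 2 := by
        rw [mul_pow]
        gcongr
        exact EllTwo.sum_norm_sq_le x _

/-- The weighted composition operator `x ↦ (i ↦ c i (x (σ i)))` between `ℓ²`-sums. -/
noncomputable def lpTransfer (σ : κ → ι) (c : κ → E →L[ℂ] F) (K : NNReal) (hK : ∀ i, ‖c i‖ ≤ K)
    (hσ : Set.InjOn σ {i | c i ≠ 0}) : EllTwo ι E →L[ℂ] EllTwo κ F :=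
  LinearMap.mkContinuous
    { toFun := fun x => ⟨fun i => c i (x (σ i)), memℓp_gen' (C := (K * ‖x‖) ^ 2) fun s => by
        simpa using sum_transfer_le hK hσ x s⟩
      map_add' := fun x y => by ext i; simp; rfl
      map_smul' := fun a x => by ext i; simp } K fun x => by
    refine lp.norm_le_of_forall_sum_le (by simp) (by positivity) fun s => ?_
    simpa using sum_transfer_le hK hσ x s

theorem norm_lpTransfer_le (σ : κ → ι) (c : κ → E →L[ℂ] F) (K : NNReal) (hK : ∀ i, ‖c i‖ ≤ K)
    (hσ : Set.InjOn σ {i | c i ≠ 0}) : ‖lpTransfer σ c K hK hσ‖ ≤ K :=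
  LinearMap.mkContinuous_norm_le _ K.2 _

/-- The operator acting as `A` on each summand. -/
noncomputable def amplify (ι : Type*) (A : E →L[ℂ] F) : EllTwo ι E →L[ℂ] EllTwo ι F :=
  lpTransfer id (fun _ => A) ‖A‖₊ (fun _ => le_rfl) Function.injective_id.injOn

@[simp]
theorem amplify_apply (A : E →L[ℂ] F) (x : EllTwo ι E) (i : ι) : amplify ι A x i = A (x i) := rfl

theorem norm_amplify_le (A : E →L[ℂ] F) : ‖amplify ι A‖ ≤ ‖A‖ := norm_lpTransfer_le _ _ _ _ _

theorem amplify_one : amplify ι (1 : E →L[ℂ] E) = 1 := by ext x i; rfl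

theorem amplify_mul (A B : E →L[ℂ] E) : amplify ι (A * B) = amplify ι A * amplify ι B := by
  ext x i; rfl

theorem amplify_pow (A : E →L[ℂ] E) (n : ℕ) : amplify ι (A ^ n) = amplify ι A ^ n := by
  induction n with
  | zero => exact amplify_one
  | succ n ih => rw [pow_succ, pow_succ, amplify_mul, ih]

end EllTwo

section Clifford

/-- The parity `(-1) ^ #{j ∈ s | j < k}`. -/
def fermionSign (s : Finset ℕ) (k : ℕ) : ℂ := ∏ j ∈ Finset.range k, if j ∈ s then -1 else 1

theorem fermionSign_mul_self (s : Finset ℕ) (k : ℕ) : fermionSign s k * fermionSign s k = 1 := by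
  rw [fermionSign, ← Finset.prod_mul_distrib]
  exact Finset.prod_eq_one fun j _ => by split_ifs <;> simp

theorem norm_fermionSign (s : Finset ℕ) (k : ℕ) : ‖fermionSign s k‖ = 1 := by
  rw [fermionSign, norm_prod]
  exact Finset.prod_eq_one fun j _ => by split_ifs <;> simp

theorem fermionSign_symmDiff (s : Finset ℕ) (k l : ℕ) :
    fermionSign (symmDiff s {k}) l = if k < l then -fermionSign s l else fermionSign s l := by
  induction l with
  | zero => simp [fermionSign]
  | succ l ih =>
    have e : ∀ t, fermionSign t (l + 1) = fermionSign t l * if l ∈ t then -1 else 1 :=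
      fun t => Finset.prod_range_succ _ _
    rw [e, e, ih]
    rcases lt_trichotomy k l with h | h | h
    · have : l ≠ k := h.ne'
      by_cases hl : l ∈ s <;>
        simp [Finset.mem_symmDiff, h, h.trans (Nat.lt_succ_self l), this, hl]
    · subst h
      by_cases hk : k ∈ s <;> simp [Finset.mem_symmDiff, hk]
    · have h1 : l ≠ k := h.ne
      have h2 : ¬ k < l := by lia
      have h3 : ¬ k < l + 1 := by lia
      simp [Finset.mem_symmDiff, h1, h2, h3]

variable (E : Type*) [NormedAddCommGroup E] [NormedSpace ℂ E]

/-- The Jordan–Wigner family of anticommuting symmetries on a sum of copies of `E`. -/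
noncomputable def clifford (k : ℕ) : EllTwo (Finset ℕ) E →L[ℂ] EllTwo (Finset ℕ) E :=
  lpTransfer (fun s => symmDiff s {k}) (fun s => fermionSign s k • ContinuousLinearMap.id ℂ E) 1
    (fun s => by
      rw [norm_smul, norm_fermionSign, one_mul]
      exact ContinuousLinearMap.norm_id_le)
    (symmDiff_left_injective {k}).injOn

variable {E}

theorem clifford_apply (k : ℕ) (x : EllTwo (Finset ℕ) E) (s : Finset ℕ) :
    clifford E k x s = fermionSign s k • x (symmDiff s {k}) := rfl

theorem norm_clifford_le (k : ℕ) : ‖clifford E k‖ ≤ 1 := norm_lpTransfer_le _ _ _ _ _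

theorem clifford_mul_self (k : ℕ) : clifford E k * clifford E k = 1 := by
  ext x s
  simp only [mul_apply_eq_comp, clifford_apply, fermionSign_symmDiff, lt_irrefl,
    if_false, smul_smul, fermionSign_mul_self, one_smul, symmDiff_symmDiff_cancel_right]
  rfl

theorem clifford_anticomm {k l : ℕ} (h : k ≠ l) :
    clifford E k * clifford E l + clifford E l * clifford E k = 0 := by
  ext x s
  simp only [mul_apply_eq_comp, _root_.add_apply, lp.coeFn_add, Pi.add_apply,
    clifford_apply, fermionSign_symmDiff, smul_smul, symmDiff_right_comm s {l} {k}]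
  rcases h.lt_or_gt with h | h
  · simp [h, h.not_gt, mul_comm]
  · simp [h, h.not_gt, mul_comm]

theorem clifford_amplify_comm (A : E →L[ℂ] E) (k : ℕ) :
    Commute (clifford E k) (amplify (Finset ℕ) A) := by
  ext x s
  simp [mul_apply_eq_comp, clifford_apply]

end Clifford

section Symmetry

variable {H : Type*} [NormedAddCommGroup H] [InnerProductSpace ℂ H] [CompleteSpace H]

theorem isSelfAdjoint_of_mul_self_eq_one {U : H →L[ℂ] H} (h1 : ‖U‖ ≤ 1) (h2 : U * U = 1) :
    IsSelfAdjoint U := by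
  have hle : ∀ x, ‖U x‖ ≤ ‖x‖ := fun x => by simpa using U.le_of_opNorm_le h1 x
  have hU : ∀ x, ‖U x‖ = ‖x‖ := fun x => by
    refine le_antisymm (hle x) ?_
    have e : U (U x) = x := congrArg (· x) h2
    simpa [e] using hle (U x)
  have h3 := U.norm_map_iff_adjoint_comp_self.1 hU
  change star U * U = 1 at h3
  change star U = U
  calc star U = star U * (U * U) := by rw [h2, mul_one]
    _ = U := by rw [← mul_assoc, h3, one_mul]

theorem linComb_clifford_bound {U : ℕ → H →L[ℂ] H} (hs : ∀ k, IsSelfAdjoint (U k))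
    (h1 : ∀ k, U k * U k = 1) (h2 : ∀ k l, k ≠ l → U k * U l + U l * U k = 0) (N : ℕ)
    (v : EuclideanSpace ℂ (Fin N)) (x : H) : ‖linComb U N v x‖ ≤ 3 / 2 * ‖v‖ * ‖x‖ := by
  set S := linComb U N v
  have hS : S = ∑ k : Fin N, v k • U k := linComb_apply _ _ _
  have hS' : star S = ∑ k : Fin N, conj (v k) • U k := by
    rw [hS, star_sum]
    exact Finset.sum_congr rfl fun k _ => by rw [star_smul, (hs k).star_eq]; rfl
  have key : star S * S + S * star S = ((2 * ‖v‖ ^ 2 : ℝ) : ℂ) • 1 := by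
    have e1 : star S * S = ∑ k : Fin N, ∑ l : Fin N, (conj (v k) * v l) • (U k * U l) := by
      rw [hS', hS, Finset.sum_mul_sum]
      simp only [smul_mul_smul_comm]
    have e2 : S * star S = ∑ k : Fin N, ∑ l : Fin N, (conj (v k) * v l) • (U l * U k) := by
      rw [hS', hS, Finset.sum_mul_sum, Finset.sum_comm]
      simp only [smul_mul_smul_comm]
      exact Finset.sum_congr rfl fun k _ => Finset.sum_congr rfl fun l _ => by rw [mul_comm]
    rw [e1, e2, ← Finset.sum_add_distrib]
    simp only [← Finset.sum_add_distrib, ← smul_add]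
    have e3 : ∀ k l : Fin N, (conj (v k) * v l) • (U k * U l + U l * U k) =
        if l = k then ((2 * ‖v k‖ ^ 2 : ℝ) : ℂ) • (1 : H →L[ℂ] H) else 0 := fun k l => by
      split_ifs with h
      · subst h
        rw [h1, ← two_smul ℂ (1 : H →L[ℂ] H), smul_smul, conj_mul']
        congr 1
        push_cast
        ring
      · rw [h2 k l fun h' => h (Fin.ext h').symm, smul_zero]
    simp only [e3, Finset.sum_ite_eq', Finset.mem_univ, if_true]
    rw [← Finset.sum_smul, EuclideanSpace.norm_sq_eq, ← ofReal_sum, Finset.mul_sum]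
  have e4 : ‖S x‖ ^ 2 + ‖star S x‖ ^ 2 = 2 * ‖v‖ ^ 2 * ‖x‖ ^ 2 := by
    have := congrArg (fun A : H →L[ℂ] H => ⟪x, A x⟫_ℂ) key
    simp only [_root_.add_apply, mul_apply_eq_comp, inner_add_right, _root_.smul_apply,
      one_apply_eq_self, inner_smul_right, inner_self_eq_norm_sq_to_K,
      ContinuousLinearMap.star_eq_adjoint, ContinuousLinearMap.adjoint_inner_right] at this
    rw [← ContinuousLinearMap.adjoint_inner_left, inner_self_eq_norm_sq_to_K] at this
    simp only [coe_algebraMap] at this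
    exact_mod_cast this
  refine le_of_sq_le_sq ?_ (by positivity)
  nlinarith [sq_nonneg ‖star S x‖, sq_nonneg (‖v‖ * ‖x‖)]

end Symmetry

section VonNeumann

variable {W : Type*} [NormedAddCommGroup W] [InnerProductSpace ℂ W]

/-- Multiplication by a bounded analytic operator symbol bounds its Toeplitz sections. -/
theorem sum_norm_sq_backward_le [CompleteSpace W] (a : ℕ → W →L[ℂ] W) (N : ℕ) {M : ℝ}
    (hM : ∀ ζ : Circle, ‖∑ n ∈ Finset.range N, (ζ : ℂ) ^ n • a n‖ ≤ M) (y : ℕ → W) (B : ℕ) :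
    ∑ b ∈ Finset.range B, ‖∑ n ∈ Finset.range N, a n (y (b + n))‖ ^ 2
      ≤ M ^ 2 * ∑ b ∈ Finset.range (B + N), ‖y b‖ ^ 2 := by
  set z : ℕ → W := fun p => ∑ n ∈ Finset.range N, ∑ b ∈ Finset.range (B + N),
    if b + N = p + n then a n (y b) else 0 with hz
  have hpoly : ∀ ζ : Circle, vecPoly z (B + N + N + 1) (conj (ζ : ℂ))
      = conj (ζ : ℂ) ^ N • (∑ n ∈ Finset.range N, (ζ : ℂ) ^ n • a n)
          (vecPoly y (B + N) (conj (ζ : ℂ))) := fun ζ => by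
    have h1 : conj (ζ : ℂ) * ζ = 1 := by
      rw [conj_mul', Circle.norm_coe]; simp
    simp only [vecPoly, hz, Finset.smul_sum, smul_ite, smul_zero, map_sum, map_smul,
      FunLike.coe_sum, Finset.sum_apply, _root_.smul_apply]
    rw [Finset.sum_comm]
    rw [Finset.sum_comm (s := Finset.range (B + N))]
    refine Finset.sum_congr rfl fun n hn => ?_
    rw [Finset.sum_comm]
    refine Finset.sum_congr rfl fun b hb => ?_
    rw [Finset.mem_range] at hn hb
    rw [Finset.sum_eq_single (b + N - n), if_pos (by lia), smul_smul, smul_smul]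
    · congr 1
      have : conj (ζ : ℂ) ^ (b + N - n) * (conj (ζ : ℂ) * ζ) ^ n
          = conj (ζ : ℂ) ^ N * (conj (ζ : ℂ) ^ b * ζ ^ n) := by
        rw [mul_pow, ← mul_assoc, ← pow_add, Nat.sub_add_cancel (by lia)]
        ring
      rw [h1, one_pow, mul_one] at this
      rw [this]
      ring
    · intro p _ hp
      rw [if_neg (by lia)]
    · intro h
      exact absurd (Finset.mem_range.2 (by lia)) h
  have hcont : ∀ (x : ℕ → W) (n : ℕ), Continuous fun ζ : Circle => vecPoly x n (conj (ζ : ℂ)) :=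
    fun x n => (continuous_vecPoly x n).comp (Complex.continuous_conj.comp Circle.continuous_coe)
  have hint : ∀ (x : ℕ → W) (n : ℕ), ∫ ζ : Circle, ‖vecPoly x n (conj (ζ : ℂ))‖ ^ 2 ∂circleHaar
      = ∑ j ∈ Finset.range n, ‖x j‖ ^ 2 := fun x n => by
    simpa using integral_norm_sq_vecPoly_conj x n 1
  calc ∑ b ∈ Finset.range B, ‖∑ n ∈ Finset.range N, a n (y (b + n))‖ ^ 2
      = ∑ b ∈ Finset.range B, ‖z (N + b)‖ ^ 2 := by
        refine Finset.sum_congr rfl fun b hb => ?_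
        rw [Finset.mem_range] at hb
        congr 2
        refine Finset.sum_congr rfl fun n hn => ?_
        rw [Finset.mem_range] at hn
        rw [Finset.sum_eq_single (b + n), if_pos (by lia)]
        · intro c _ hc
          rw [if_neg (by lia)]
        · intro h
          exact absurd (Finset.mem_range.2 (by lia)) h
    _ ≤ ∑ p ∈ Finset.range (B + N + N + 1), ‖z p‖ ^ 2 := by
        rw [← Finset.sum_image (f := fun p => ‖z p‖ ^ 2) (g := fun b => N + b)
          (fun _ _ _ _ h => Nat.add_left_cancel h)]
        refine Finset.sum_le_sum_of_subset_of_nonneg (fun p hp => ?_) fun _ _ _ => sq_nonneg _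
        simp only [Finset.mem_image, Finset.mem_range] at hp ⊢
        lia
    _ = ∫ ζ : Circle, ‖vecPoly z (B + N + N + 1) (conj (ζ : ℂ))‖ ^ 2 ∂circleHaar := (hint _ _).symm
    _ ≤ ∫ ζ : Circle, M ^ 2 * ‖vecPoly y (B + N) (conj (ζ : ℂ))‖ ^ 2 ∂circleHaar := by
        refine integral_mono ((hcont _ _).norm.pow 2).integrable_circleHaar
          (continuous_const.mul ((hcont _ _).norm.pow 2)).integrable_circleHaar fun ζ => ?_
        simp only [hpoly, norm_smul, norm_pow, RCLike.norm_conj, Circle.norm_coe, one_pow, one_mul]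
        rw [← mul_pow]
        gcongr
        exact ContinuousLinearMap.le_of_opNorm_le _ (hM ζ) _
    _ = M ^ 2 * ∑ b ∈ Finset.range (B + N), ‖y b‖ ^ 2 := by
        rw [integral_const_mul, hint]

variable [CompleteSpace W]

theorem norm_defect_sq {R : W →L[ℂ] W} (hR : ‖R‖ ≤ 1) (x : W) :
    ‖CFC.sqrt (1 - star R * R) x‖ ^ 2 = ‖x‖ ^ 2 - ‖R x‖ ^ 2 := by
  have h0 : 0 ≤ 1 - star R * R := by
    rw [ContinuousLinearMap.nonneg_iff_isPositive, ContinuousLinearMap.isPositive_def']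
    refine ⟨(IsSelfAdjoint.one _).sub (IsSelfAdjoint.star_mul_self R), fun v => ?_⟩
    have hv : ‖R v‖ ≤ ‖v‖ := by simpa using R.le_of_opNorm_le hR v
    have e : ⟪(1 - star R * R) v, v⟫_ℂ = ((‖v‖ ^ 2 - ‖R v‖ ^ 2 : ℝ) : ℂ) := by
      simp [ContinuousLinearMap.star_eq_adjoint,
        ContinuousLinearMap.adjoint_inner_left, inner_self_eq_norm_sq_to_K]
    rw [ContinuousLinearMap.reApplyInnerSelf_apply, e, RCLike.re_eq_complex_re, ofReal_re]
    nlinarith [norm_nonneg (R v)]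
  set D := CFC.sqrt (1 - star R * R) with hD
  have hs : star D = D := (CFC.sqrt_nonneg _).star_eq
  have hDD : star D * D = 1 - star R * R := by rw [hs, hD, CFC.sqrt_mul_sqrt_self _ h0]
  have h := congrArg (fun A : W →L[ℂ] W => ⟪x, A x⟫_ℂ) hDD
  simp only [ContinuousLinearMap.star_eq_adjoint, _root_.sub_apply, mul_apply_eq_comp,
    ContinuousLinearMap.adjoint_inner_right, inner_sub_right, one_apply_eq_self,
    inner_self_eq_norm_sq_to_K, coe_algebraMap] at h
  exact_mod_cast h

theorem norm_sum_mul_pow_le_of_lt {R : W →L[ℂ] W} (hR : ‖R‖ < 1) {a : ℕ → W →L[ℂ] W}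
    (hc : ∀ n, Commute (a n) R) (hc' : ∀ n, Commute (a n) (star R)) {N : ℕ} {M : ℝ}
    (hM : ∀ ζ : Circle, ‖∑ n ∈ Finset.range N, (ζ : ℂ) ^ n • a n‖ ≤ M) :
    ‖∑ n ∈ Finset.range N, a n * R ^ n‖ ≤ M := by
  have hM0 : 0 ≤ M := (norm_nonneg _).trans (hM 1)
  refine ContinuousLinearMap.opNorm_le_bound _ hM0 fun x => ?_
  set S := ∑ n ∈ Finset.range N, a n * R ^ n with hS
  set D := CFC.sqrt (1 - star R * R) with hD
  have hDa : ∀ n, Commute D (a n) := fun n =>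
    Commute.cfcₙ_nnreal ((Commute.one_left _).sub_left ((hc' n).symm.mul_left (hc n).symm)) _
  have hSR : ∀ b, Commute S (R ^ b) := fun b =>
    Commute.sum_left _ _ _ fun n _ => ((hc n).pow_right b).mul_left (Commute.pow_pow_self R n b)
  have tel : ∀ (v : W) (B : ℕ), ∑ b ∈ Finset.range B, ‖D ((R ^ b) v)‖ ^ 2
      = ‖v‖ ^ 2 - ‖(R ^ B) v‖ ^ 2 := fun v B => by
    rw [Finset.sum_congr rfl fun b _ => norm_defect_sq hR.le ((R ^ b) v)]
    have e : ∀ b, R ((R ^ b) v) = (R ^ (b + 1)) v := fun b => by rw [pow_succ']; rfl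
    simp only [e]
    rw [Finset.sum_range_sub' (fun b => ‖(R ^ b) v‖ ^ 2)]
    simp
  have hB : ∀ B, ‖S x‖ ^ 2 - ‖(R ^ B) (S x)‖ ^ 2 ≤ (M * ‖x‖) ^ 2 := fun B => by
    rw [← tel]
    have e : ∀ b, D ((R ^ b) (S x)) = ∑ n ∈ Finset.range N, a n (D ((R ^ (b + n)) x)) := fun b => by
      have : D * (R ^ b * S) = ∑ n ∈ Finset.range N, a n * (D * R ^ (b + n)) := by
        rw [← (hSR b).eq, hS, Finset.sum_mul, Finset.mul_sum]
        refine Finset.sum_congr rfl fun n _ => ?_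
        rw [mul_assoc, ← mul_assoc, (hDa n).eq, mul_assoc, ← pow_add, add_comm]
      have := congrArg (fun A : W →L[ℂ] W => A x) this
      simpa [FunLike.coe_sum] using this
    simp only [e]
    refine (sum_norm_sq_backward_le a N hM (fun b => D ((R ^ b) x)) B).trans ?_
    rw [tel, mul_pow]
    gcongr
    linarith [sq_nonneg ‖(R ^ (B + N)) x‖]
  have hlim : Filter.Tendsto (fun B => ‖S x‖ ^ 2 - ‖(R ^ B) (S x)‖ ^ 2) Filter.atTop
      (nhds (‖S x‖ ^ 2 - 0 ^ 2)) := by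
    refine tendsto_const_nhds.sub (Filter.Tendsto.pow ?_ 2)
    refine squeeze_zero (fun _ => norm_nonneg _) (fun B => ?_)
      (by simpa using (tendsto_pow_atTop_nhds_zero_of_lt_one (norm_nonneg R) hR).mul_const ‖S x‖)
    induction B with
    | zero => simp
    | succ B ih =>
      rw [pow_succ' R, pow_succ', mul_assoc]
      exact (R.le_opNorm _).trans (mul_le_mul_of_nonneg_left ih (norm_nonneg R))
  have := le_of_tendsto' hlim hB
  refine le_of_sq_le_sq ?_ (by positivity)
  simpa using this

/-- A von Neumann inequality for analytic symbols with coefficients in the commutant. -/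
theorem norm_sum_mul_pow_le {R : W →L[ℂ] W} (hR : ‖R‖ ≤ 1) {a : ℕ → W →L[ℂ] W}
    (hc : ∀ n, Commute (a n) R) (hc' : ∀ n, Commute (a n) (star R)) {N : ℕ} {M : ℝ}
    (hM : ∀ ζ : Circle, ‖∑ n ∈ Finset.range N, (ζ : ℂ) ^ n • a n‖ ≤ M) :
    ‖∑ n ∈ Finset.range N, a n * R ^ n‖ ≤ M := by
  have hcont : Continuous fun t : ℝ => ‖∑ n ∈ Finset.range N, a n * ((t : ℂ) • R) ^ n‖ := by
    have : Continuous fun t : ℝ => (t : ℂ) • R := continuous_ofReal.smul continuous_const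
    fun_prop
  have hlim := hcont.continuousAt.tendsto.mono_left
    (nhdsWithin_le_nhds (a := (1 : ℝ)) (s := Set.Iio 1))
  simp only [ofReal_one, one_smul] at hlim
  refine le_of_tendsto hlim ?_
  filter_upwards [Ioo_mem_nhdsLT (zero_lt_one (α := ℝ))] with t ht
  refine norm_sum_mul_pow_le_of_lt ?_ (fun n => (hc n).smul_right _) (fun n => ?_) hM
  · rw [norm_smul, norm_real, Real.norm_of_nonneg ht.1.le]
    nlinarith [ht.1, ht.2]
  · rw [star_smul]
    exact (hc' n).smul_right _

end VonNeumann

section Foguel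

/-- The index map of the sum of a backward and a forward shift. -/
def foguelIndex (i : Bool × ℕ) : Bool × ℕ := (i.1, if i.1 then i.2 - 1 else i.2 + 1)

variable (H : Type*) [NormedAddCommGroup H] [InnerProductSpace ℂ H]

/-- The backward shift on the `false` summand plus the forward shift on the `true` summand. -/
noncomputable def foguelShift : EllTwo (Bool × ℕ) H →L[ℂ] EllTwo (Bool × ℕ) H :=
  lpTransfer foguelIndex (fun i => if i = (true, 0) then 0 else ContinuousLinearMap.id ℂ H) 1
    (fun i => by
      split_ifs
      · simp
      · exact ContinuousLinearMap.norm_id_le)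
    (by
      rintro ⟨a, i⟩ hi ⟨b, j⟩ hj h
      have hi' : (a, i) ≠ (true, 0) := fun h => hi (if_pos h)
      have hj' : (b, j) ≠ (true, 0) := fun h => hj (if_pos h)
      cases a <;> cases b <;> (simp_all [foguelIndex]; try lia))

variable {H}

theorem norm_foguelShift_le : ‖foguelShift H‖ ≤ 1 := norm_lpTransfer_le _ _ _ _ _

theorem foguelShift_apply (x : EllTwo (Bool × ℕ) H) (i : Bool × ℕ) :
    foguelShift H x i
      = (if i = (true, 0) then 0 else ContinuousLinearMap.id ℂ H) (x (foguelIndex i)) := rfl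

theorem foguelShift_apply_false (x : EllTwo (Bool × ℕ) H) (i : ℕ) :
    foguelShift H x (false, i) = x (false, i + 1) := by
  simp [foguelShift_apply, foguelIndex]

theorem foguelShift_apply_true (x : EllTwo (Bool × ℕ) H) (i : ℕ) :
    foguelShift H x (true, i) = if i = 0 then 0 else x (true, i - 1) := by
  by_cases h : i = 0 <;> simp [foguelShift_apply, foguelIndex, h]

theorem foguelShift_pow_apply_false (x : EllTwo (Bool × ℕ) H) (m i : ℕ) :
    (foguelShift H ^ m) x (false, i) = x (false, i + m) := by
  induction m generalizing i with
  | zero => simp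
  | succ m ih =>
    rw [pow_succ', mul_apply_eq_comp, foguelShift_apply_false, ih]
    lia

theorem foguelShift_pow_apply_true {x : EllTwo (Bool × ℕ) H} (hx : ∀ i, x (true, i) = 0)
    (m i : ℕ) : (foguelShift H ^ m) x (true, i) = 0 := by
  induction m generalizing i with
  | zero => simpa using hx i
  | succ m ih =>
    rw [pow_succ', mul_apply_eq_comp, foguelShift_apply_true, ih, ite_self]

/-- The finite Hankel block with entry `U k` on the antidiagonal `i + j = 2 ^ (k + 1) - 1`. -/
noncomputable def foguelBlock (U : ℕ → H →L[ℂ] H) (k : ℕ) :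
    EllTwo (Bool × ℕ) H →L[ℂ] EllTwo (Bool × ℕ) H :=
  lpTransfer (fun i => (true, 2 ^ (k + 1) - 1 - i.2))
    (fun i => if i.1 = false ∧ i.2 < 2 ^ (k + 1) then U k else 0) ‖U k‖₊
    (fun i => by split_ifs <;> simp)
    (by
      rintro ⟨a, i⟩ hi ⟨b, j⟩ hj h
      have hi' : a = false ∧ i < 2 ^ (k + 1) := by
        by_contra h
        exact hi (if_neg h)
      have hj' : b = false ∧ j < 2 ^ (k + 1) := by
        by_contra h
        exact hj (if_neg h)
      simp only [Prod.mk.injEq, true_and] at h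
      refine Prod.ext (hi'.1.trans hj'.1.symm) ?_
      change i = j
      lia)

variable {U : ℕ → H →L[ℂ] H}

theorem norm_foguelBlock_le (k : ℕ) : ‖foguelBlock U k‖ ≤ ‖U k‖ := norm_lpTransfer_le _ _ _ _ _

theorem foguelBlock_apply (k : ℕ) (x : EllTwo (Bool × ℕ) H) (i : Bool × ℕ) :
    foguelBlock U k x i
      = (if i.1 = false ∧ i.2 < 2 ^ (k + 1) then U k else 0) (x (true, 2 ^ (k + 1) - 1 - i.2)) :=
  rfl

theorem foguelBlock_apply_false (k : ℕ) (x : EllTwo (Bool × ℕ) H) (i : ℕ) :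
    foguelBlock U k x (false, i)
      = if i < 2 ^ (k + 1) then U k (x (true, 2 ^ (k + 1) - 1 - i)) else 0 := by
  by_cases h : i < 2 ^ (k + 1) <;> simp [foguelBlock_apply, h]

theorem foguelBlock_apply_true (k : ℕ) (x : EllTwo (Bool × ℕ) H) (i : ℕ) :
    foguelBlock U k x (true, i) = 0 := by
  simp [foguelBlock_apply]

theorem foguelBlock_mul (k l : ℕ) : foguelBlock U k * foguelBlock U l = 0 := by
  ext x ⟨b, i⟩
  cases b
  · simp [mul_apply_eq_comp, foguelBlock_apply_false, foguelBlock_apply_true]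
  · simp [mul_apply_eq_comp, foguelBlock_apply_true]

theorem foguelBlock_mul_foguelShift (k : ℕ) :
    foguelBlock U k * foguelShift H = foguelShift H * foguelBlock U k := by
  ext x ⟨b, i⟩
  cases b
  · simp only [mul_apply_eq_comp, foguelBlock_apply_false, foguelShift_apply_false,
      foguelShift_apply_true]
    by_cases h : i + 1 < 2 ^ (k + 1)
    · rw [if_pos (by lia), if_neg (by lia), if_pos h]
      congr 3
    · rw [if_neg h]
      split_ifs with h1 h2
      · simp
      · lia
      · rfl
  · simp [mul_apply_eq_comp, foguelBlock_apply_true, foguelShift_apply_true]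

variable (U) in
/-- The off-diagonal part of the Foguel–Hankel operator. -/
noncomputable def foguelHankel : EllTwo (Bool × ℕ) H →L[ℂ] EllTwo (Bool × ℕ) H :=
  ∑' k, ((2 : ℂ) ^ (k + 1))⁻¹ • foguelBlock U k

theorem summable_foguelBlock [CompleteSpace H] (hU : ∀ k, ‖U k‖ ≤ 1) :
    Summable fun k => ((2 : ℂ) ^ (k + 1))⁻¹ • foguelBlock U k := by
  refine Summable.of_norm_bounded (g := fun k : ℕ => (1 / 2 : ℝ) ^ k) (by
    exact summable_geometric_of_lt_one (by norm_num) (by norm_num)) fun k => ?_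
  rw [norm_smul, norm_inv, norm_pow, RCLike.norm_ofNat, ← inv_pow, pow_succ, one_div]
  have := (norm_foguelBlock_le (U := U) k).trans (hU k)
  have h2 : 0 < ((2 : ℝ)⁻¹) ^ k := by positivity
  nlinarith [norm_nonneg (foguelBlock U k)]

theorem foguelHankel_mul_self [CompleteSpace H] (hU : ∀ k, ‖U k‖ ≤ 1) :
    foguelHankel U * foguelHankel U = 0 := by
  have hs := summable_foguelBlock hU
  unfold foguelHankel
  rw [← hs.tsum_mul_right]
  simp_rw [← hs.tsum_mul_left, smul_mul_smul_comm, foguelBlock_mul]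
  simp

theorem commute_foguelShift_foguelHankel [CompleteSpace H] (hU : ∀ k, ‖U k‖ ≤ 1) :
    Commute (foguelShift H) (foguelHankel U) := by
  have hs := summable_foguelBlock hU
  unfold Commute SemiconjBy foguelHankel
  rw [← hs.tsum_mul_right, ← hs.tsum_mul_left]
  simp_rw [smul_mul_assoc, mul_smul_comm, foguelBlock_mul_foguelShift]

theorem aeval_add_of_mul_self_eq_zero {A : Type*} [Ring A] [Algebra ℂ A] {S G : A}
    (hG : G * G = 0) (hc : Commute S G) (p : Polynomial ℂ) :
    Polynomial.aeval (S + G) p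
      = Polynomial.aeval S p + Polynomial.aeval S p.derivative * G := by
  induction p using Polynomial.induction_on' with
  | add p q hp hq => simp only [map_add, hp, hq, add_mul]; abel
  | monomial n a =>
    have key : ∀ n : ℕ, (S + G) ^ n = S ^ n + (n : A) * S ^ (n - 1) * G := fun n => by
      induction n with
      | zero => simp
      | succ n ih =>
        rw [pow_succ', ih, Nat.add_sub_cancel]
        rcases n with _ | n
        · simp
        · rw [Nat.add_sub_cancel]
          have e1 : G * (((n + 1 : ℕ) : A) * S ^ n * G) = 0 := by
            rw [mul_assoc, ← mul_assoc G, ((Nat.cast_commute (n + 1) G).symm).eq, mul_assoc,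
              ← mul_assoc G, ((hc.symm).pow_right n).eq, mul_assoc, hG, mul_zero, mul_zero]
          have e2 : G * S ^ (n + 1) = S ^ (n + 1) * G := ((hc.symm).pow_right (n + 1)).eq
          have e3 : S * (((n + 1 : ℕ) : A) * S ^ n * G) = ((n + 1 : ℕ) : A) * S ^ (n + 1) * G := by
            rw [← mul_assoc, ← mul_assoc, ((Nat.cast_commute (n + 1) S).symm).eq, mul_assoc _ S,
              ← pow_succ']
          rw [add_mul, mul_add, mul_add, e1, e2, e3, add_zero, ← pow_succ' S]
          push_cast
          noncomm_ring
    rw [Polynomial.derivative_monomial, Polynomial.aeval_monomial, Polynomial.aeval_monomial,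
      Polynomial.aeval_monomial, key, mul_add, map_mul, map_natCast]
    simp only [mul_assoc]

theorem norm_aeval_le_of_norm_le_one [CompleteSpace H] {R : H →L[ℂ] H} (hR : ‖R‖ ≤ 1)
    {p : Polynomial ℂ} {M : ℝ} (hp : ∀ z : ℂ, ‖z‖ ≤ 1 → ‖p.eval z‖ ≤ M) :
    ‖Polynomial.aeval R p‖ ≤ M := by
  have hc : ∀ (n : ℕ) (A : H →L[ℂ] H), Commute (p.coeff n • (1 : H →L[ℂ] H)) A :=
    fun n A => (Commute.one_left A).smul_left _
  have hM : ∀ ζ : Circle, ‖∑ n ∈ Finset.range (p.natDegree + 1),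
      (ζ : ℂ) ^ n • (p.coeff n • (1 : H →L[ℂ] H))‖ ≤ M := fun ζ => by
    simp only [smul_smul]
    rw [← Finset.sum_smul, norm_smul]
    have e : ∑ n ∈ Finset.range (p.natDegree + 1), (ζ : ℂ) ^ n * p.coeff n = p.eval (ζ : ℂ) := by
      rw [Polynomial.eval_eq_sum_range]
      exact Finset.sum_congr rfl fun _ _ => mul_comm _ _
    rw [e]
    calc ‖p.eval (ζ : ℂ)‖ * ‖(1 : H →L[ℂ] H)‖ ≤ ‖p.eval (ζ : ℂ)‖ * 1 := by
          gcongr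
          exact ContinuousLinearMap.norm_id_le
      _ ≤ M := by
          rw [mul_one]
          exact hp _ (Circle.norm_coe ζ).le
  have := norm_sum_mul_pow_le hR (fun n => hc n R) (fun n => hc n _) hM
  rw [Polynomial.aeval_eq_sum_range]
  simpa using this

theorem inner_foguelShift_pow_foguelBlock (x y : EllTwo (Bool × ℕ) H) (k m : ℕ) {D : ℕ}
    (hD : 2 ^ (k + 1) ≤ D) :
    ⟪y, (foguelShift H ^ m) (foguelBlock U k x)⟫_ℂ
      = ∑ i ∈ Finset.range D, ∑ j ∈ Finset.range D,
          if m + i + j = 2 ^ (k + 1) - 1 then ⟪y (false, i), U k (x (true, j))⟫_ℂ else 0 := by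
  have hpos : 0 < 2 ^ (k + 1) := by positivity
  rw [lp.inner_eq_tsum, tsum_eq_sum (s := (Finset.range D).map
    ⟨fun i => (false, i), fun _ _ h => (Prod.mk.inj h).2⟩), Finset.sum_map]
  · refine Finset.sum_congr rfl fun i _ => ?_
    change ⟪y (false, i), (foguelShift H ^ m) (foguelBlock U k x) (false, i)⟫_ℂ = _
    rw [foguelShift_pow_apply_false, foguelBlock_apply_false]
    split_ifs with h
    · rw [Finset.sum_eq_single (2 ^ (k + 1) - 1 - (i + m)), if_pos (by lia)]
      · intro j _ hj
        rw [if_neg (by lia)]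
      · intro h'
        exact absurd (Finset.mem_range.2 (by lia)) h'
    · rw [inner_zero_right, Finset.sum_eq_zero]
      intro j _
      rw [if_neg (by lia)]
  · rintro ⟨b, i⟩ hi
    cases b
    · have : ¬ i < D := fun h => hi (Finset.mem_map.2 ⟨i, Finset.mem_range.2 h, rfl⟩)
      rw [foguelShift_pow_apply_false, foguelBlock_apply_false, if_neg (by lia), inner_zero_right]
    · rw [foguelShift_pow_apply_true (foguelBlock_apply_true k x), inner_zero_right]

theorem inner_aeval_foguelShift_foguelBlock (x y : EllTwo (Bool × ℕ) H) (f : Polynomial ℂ)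
    (k : ℕ) {D : ℕ} (hD : 2 ^ (k + 1) ≤ D) :
    ⟪y, Polynomial.aeval (foguelShift H) f.derivative
        ((((2 : ℂ) ^ (k + 1))⁻¹ • foguelBlock U k) x)⟫_ℂ
      = hankelTerm U (fun j => x (true, j)) (fun i => y (false, i)) D f k := by
  rw [hankelTerm_eq, Polynomial.aeval_eq_sum_range, _root_.smul_apply, map_smul, inner_smul_right,
    FunLike.coe_sum, Finset.sum_apply, inner_sum]
  congr 1
  refine Finset.sum_congr rfl fun m _ => ?_
  rw [_root_.smul_apply, inner_smul_right, inner_foguelShift_pow_foguelBlock x y k m hD,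
    Finset.mul_sum]
  simp only [Finset.mul_sum, mul_ite, mul_zero]

theorem opNorm_le_of_norm_inner_le {C : ℝ} (hC : 0 ≤ C) {S : H →L[ℂ] H}
    (h : ∀ x y, ‖⟪y, S x⟫_ℂ‖ ≤ C * (‖x‖ ^ 2 + ‖y‖ ^ 2)) : ‖S‖ ≤ 2 * C := by
  refine S.opNorm_le_bound (by positivity) fun x => ?_
  rcases eq_or_ne (S x) 0 with h0 | h0
  · rw [h0, norm_zero]
    positivity
  have hx : x ≠ 0 := fun hx => h0 (by simp [hx])
  have hS : 0 < ‖S x‖ := norm_pos_iff.2 h0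
  have hx' : 0 < ‖x‖ := norm_pos_iff.2 hx
  have := h x (((‖x‖ / ‖S x‖ : ℝ) : ℂ) • S x)
  rw [inner_smul_left, norm_mul, RCLike.norm_conj, norm_real, Real.norm_of_nonneg (by positivity),
    norm_smul, norm_real, Real.norm_of_nonneg (by positivity), inner_self_eq_norm_sq_to_K,
    norm_pow, RCLike.norm_ofReal, abs_norm, div_mul_cancel₀ _ hS.ne', sq ‖S x‖,
    ← mul_assoc, div_mul_cancel₀ _ hS.ne'] at this
  nlinarith

theorem EllTwo.sum_norm_sq_mk_le {E : Type*} [NormedAddCommGroup E] (x : EllTwo (Bool × ℕ) E)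
    (b : Bool) (D : ℕ) :
    ∑ j ∈ Finset.range D, ‖x (b, j)‖ ^ 2 ≤ ‖x‖ ^ 2 := by
  have := EllTwo.sum_norm_sq_le x ((Finset.range D).map
    ⟨fun i => (b, i), fun _ _ h => (Prod.mk.inj h).2⟩)
  rwa [Finset.sum_map] at this

theorem norm_aeval_derivative_mul_foguelHankel_le [CompleteSpace H]
    (hU : ∀ N v x, ‖linComb U N v x‖ ≤ 3 / 2 * ‖v‖ * ‖x‖) (hU' : ∀ k, ‖U k‖ ≤ 1)
    {f : Polynomial ℂ} (hf : ∀ z : ℂ, ‖z‖ ≤ 1 → ‖f.eval z‖ ≤ 1) :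
    ‖Polynomial.aeval (foguelShift H) f.derivative * foguelHankel U‖ ≤ 8464 := by
  set Q := Polynomial.aeval (foguelShift H) f.derivative
  have hlim := (((summable_foguelBlock hU').hasSum.tendsto_sum_nat).const_mul Q).norm
  refine le_of_tendsto' hlim fun N => ?_
  rw [show (8464 : ℝ) = 2 * 4232 by norm_num]
  refine opNorm_le_of_norm_inner_le (by norm_num) fun x y => ?_
  have e : ⟪y, (Q * ∑ k ∈ Finset.range N, ((2 : ℂ) ^ (k + 1))⁻¹ • foguelBlock U k) x⟫_ℂ
      = ∑ k ∈ Finset.range N,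
          hankelTerm U (fun j => x (true, j)) (fun i => y (false, i)) (2 ^ N) f k := by
    rw [Finset.mul_sum, FunLike.coe_sum, Finset.sum_apply, inner_sum]
    refine Finset.sum_congr rfl fun k hk => ?_
    rw [← inner_aeval_foguelShift_foguelBlock x y f k
      (Nat.pow_le_pow_right two_pos (Finset.mem_range.1 hk)), mul_apply_eq_comp]
  rw [e]
  refine (norm_sum_hankelTerm_le (hU N) _ _ _ hf).trans ?_
  gcongr <;> exact EllTwo.sum_norm_sq_mk_le _ _ _

theorem norm_aeval_foguel_le [CompleteSpace H]
    (hU : ∀ N v x, ‖linComb U N v x‖ ≤ 3 / 2 * ‖v‖ * ‖x‖) (hU' : ∀ k, ‖U k‖ ≤ 1)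
    {p : Polynomial ℂ} {M : ℝ} (hM : 0 < M) (hp : ∀ z : ℂ, ‖z‖ ≤ 1 → ‖p.eval z‖ ≤ M) :
    ‖Polynomial.aeval (foguelShift H + foguelHankel U) p‖ ≤ 8465 * M := by
  set f : Polynomial ℂ := (M : ℂ)⁻¹ • p with hf
  have hpf : p = (M : ℂ) • f := by
    rw [hf, smul_inv_smul₀ (by exact_mod_cast hM.ne')]
  have hf1 : ∀ z : ℂ, ‖z‖ ≤ 1 → ‖f.eval z‖ ≤ 1 := fun z hz => by
    rw [hf, Polynomial.eval_smul, norm_smul, norm_inv, norm_real, Real.norm_of_nonneg hM.le,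
      inv_mul_le_iff₀ hM, mul_one]
    exact hp z hz
  have h1 := norm_aeval_le_of_norm_le_one norm_foguelShift_le hf1 (H := EllTwo (Bool × ℕ) H)
  have h2 := norm_aeval_derivative_mul_foguelHankel_le hU hU' hf1
  rw [hpf, map_smul, norm_smul, norm_real, Real.norm_of_nonneg hM.le, mul_comm,
    aeval_add_of_mul_self_eq_zero (foguelHankel_mul_self hU')
      (commute_foguelShift_foguelHankel hU')]
  gcongr
  exact (norm_add_le _ _).trans (by linarith)

end Foguel

section NotSimilar

variable {W : Type*} [NormedAddCommGroup W] [InnerProductSpace ℂ W] [CompleteSpace W]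

theorem isSelfAdjoint_clifford (k : ℕ) : IsSelfAdjoint (clifford W k) :=
  isSelfAdjoint_of_mul_self_eq_one (norm_clifford_le k) (clifford_mul_self k)

theorem norm_linComb_clifford_le (N : ℕ) (v : EuclideanSpace ℂ (Fin N)) (x : EllTwo (Finset ℕ) W) :
    ‖linComb (clifford W) N v x‖ ≤ 3 / 2 * ‖v‖ * ‖x‖ :=
  linComb_clifford_bound isSelfAdjoint_clifford clifford_mul_self (fun _ _ => clifford_anticomm)
    N v x

/-- Fermionic sums of powers of a contraction have norm of order `√N`. -/
theorem norm_sum_clifford_mul_pow_le {R : W →L[ℂ] W} (hR : ‖R‖ ≤ 1) (e : ℕ → ℕ) (N : ℕ) :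
    ‖∑ l ∈ Finset.range N, clifford W l * amplify (Finset ℕ) (R ^ e l)‖ ≤ 3 / 2 * √N := by
  set V := clifford W
  set S := amplify (Finset ℕ) R with hS
  have hS1 : ‖S‖ ≤ 1 := (norm_amplify_le R).trans hR
  set a : ℕ → EllTwo (Finset ℕ) W →L[ℂ] EllTwo (Finset ℕ) W :=
    fun n => ∑ l ∈ Finset.range N, if n = e l then V l else 0 with ha
  have hVS : ∀ l, Commute (V l) S := clifford_amplify_comm R
  have hVS' : ∀ l, Commute (V l) (star S) := fun l => by
    have := (hVS l).star_star
    rwa [(isSelfAdjoint_clifford (W := W) l).star_eq] at this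
  have hc : ∀ B, (∀ l, Commute (V l) B) → ∀ n, Commute (a n) B := fun B hB n =>
    Commute.sum_left _ _ _ fun l _ => by
      split_ifs
      · exact hB l
      · exact Commute.zero_left B
  set L := (Finset.range N).sup e + 1
  have hL : ∀ l ∈ Finset.range N, e l ∈ Finset.range L := fun l hl =>
    Finset.mem_range.2 (Nat.lt_succ_of_le (Finset.le_sup hl))
  have hsum : ∀ g : ℕ → (EllTwo (Finset ℕ) W →L[ℂ] EllTwo (Finset ℕ) W) →ₗ[ℂ]
      (EllTwo (Finset ℕ) W →L[ℂ] EllTwo (Finset ℕ) W),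
      ∑ n ∈ Finset.range L, g n (a n) = ∑ l ∈ Finset.range N, g (e l) (V l) := fun g => by
    simp only [ha, map_sum]
    rw [Finset.sum_comm]
    refine Finset.sum_congr rfl fun l hl => ?_
    rw [Finset.sum_eq_single (e l), if_pos rfl]
    · intro n _ hn
      rw [if_neg hn, map_zero]
    · exact fun h => absurd (hL l hl) h
  have key := norm_sum_mul_pow_le hS1 (hc _ hVS) (hc _ hVS') (N := L) (M := 3 / 2 * √N) fun ζ => by
    have h1 := hsum fun n => (ζ : ℂ) ^ n • LinearMap.id
    simp only [LinearMap.smul_apply, LinearMap.id_apply] at h1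
    rw [h1, ← Fin.sum_univ_eq_sum_range (fun l => (ζ : ℂ) ^ e l • V l)]
    set v : EuclideanSpace ℂ (Fin N) := WithLp.toLp 2 fun l => (ζ : ℂ) ^ e l
    have hv : ‖v‖ = √N := by
      rw [EuclideanSpace.norm_eq]
      congr 1
      have : ∀ l, ‖v l‖ ^ 2 = 1 := fun l => by
        change ‖(ζ : ℂ) ^ e l‖ ^ 2 = 1
        rw [norm_pow, Circle.norm_coe, one_pow, one_pow]
      simp [this]
    have h2 : ∑ l : Fin N, (ζ : ℂ) ^ e l • V l = linComb V N v := (linComb_apply V N v).symm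
    rw [h2, ← hv]
    exact ContinuousLinearMap.opNorm_le_bound _ (by positivity) (norm_linComb_clifford_le N v)
  have h3 := hsum fun n => LinearMap.mulRight ℂ (S ^ n)
  simp only [LinearMap.mulRight_apply] at h3
  rw [h3] at key
  simpa only [amplify_pow] using key

theorem foguelHankel_apply_single {U : ℕ → W →L[ℂ] W} (hU : ∀ k, ‖U k‖ ≤ 1) (l : ℕ) (v : W) :
    foguelHankel U (lp.single 2 (true, 0) v) (false, 2 ^ (l + 1) - 1)
      = ((2 : ℂ) ^ (l + 1))⁻¹ • U l v := by
  set x : EllTwo (Bool × ℕ) W := lp.single 2 (true, 0) v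
  have h := (((summable_foguelBlock hU).hasSum.mapL (ContinuousLinearMap.apply ℂ _ x)).mapL
    (lp.evalCLM ℂ (fun _ : Bool × ℕ => W) 2 (false, 2 ^ (l + 1) - 1)))
  refine h.unique ?_
  have e : ∀ k, lp.evalCLM ℂ (fun _ : Bool × ℕ => W) 2 (false, 2 ^ (l + 1) - 1)
      (ContinuousLinearMap.apply ℂ _ x (((2 : ℂ) ^ (k + 1))⁻¹ • foguelBlock U k))
      = ((2 : ℂ) ^ (k + 1))⁻¹ • foguelBlock U k x (false, 2 ^ (l + 1) - 1) := fun k => rfl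
  simp only [e, foguelBlock_apply_false]
  have hpos : ∀ k, 0 < 2 ^ (k + 1) := fun k => by positivity
  have hl := hpos l
  convert hasSum_single l fun k hk => ?_ using 1
  · rw [if_pos (by lia), Nat.sub_self, show x (true, 0) = v from lp.single_apply_self _ _ _]
  · split_ifs with h
    · have hlt : 2 ^ (l + 1) < 2 ^ (k + 1) :=
        lt_of_le_of_ne (by lia) fun h' => hk (by simpa using h'.symm)
      rw [show x (true, 2 ^ (k + 1) - 1 - (2 ^ (l + 1) - 1)) = 0 from
        lp.single_apply_ne _ _ _ (by simp; lia), map_zero, smul_zero]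
    · rw [smul_zero]

theorem foguel_pow_apply_single {U : ℕ → W →L[ℂ] W} (hU : ∀ k, ‖U k‖ ≤ 1) (l : ℕ) (v : W) :
    ((foguelShift W + foguelHankel U) ^ 2 ^ (l + 1)) (lp.single 2 (true, 0) v) (false, 0)
      = U l v := by
  have h := aeval_add_of_mul_self_eq_zero (foguelHankel_mul_self hU)
    (commute_foguelShift_foguelHankel hU) (Polynomial.X ^ 2 ^ (l + 1))
  simp only [map_pow, Polynomial.aeval_X, Polynomial.derivative_X_pow, map_mul,
    Polynomial.aeval_C] at h
  rw [h, Algebra.algebraMap_eq_smul_one, smul_one_mul, smul_mul_assoc]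
  change (foguelShift W ^ 2 ^ (l + 1)) (lp.single 2 (true, 0) v) (false, 0) +
    ((2 ^ (l + 1) : ℕ) : ℂ) • (foguelShift W ^ (2 ^ (l + 1) - 1))
      (foguelHankel U (lp.single 2 (true, 0) v)) (false, 0) = _
  rw [foguelShift_pow_apply_false, foguelShift_pow_apply_false, zero_add, zero_add,
    foguelHankel_apply_single hU, lp.single_apply_ne _ _ _ (by simp), zero_add, smul_smul]
  push_cast
  rw [mul_inv_cancel₀ (pow_ne_zero _ two_ne_zero), one_smul]

theorem norm_sum_single_sq {ι E : Type*} [DecidableEq ι] [NormedAddCommGroup E] (f : ι → E)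
    (hf : ∀ i, ‖f i‖ = 1) (s : Finset ι) :
    ‖(∑ i ∈ s, lp.single 2 i (f i) : EllTwo ι E)‖ ^ 2 = s.card := by
  have := lp.norm_sum_single (p := 2) (by simp) f s
  simpa [hf] using this

theorem norm_sum_clifford_mul_pow_le_of_conj {A A' T : W →L[ℂ] W} (h : A' * A = 1)
    (hle : ‖A * T * A'‖ ≤ 1) (e : ℕ → ℕ) (N : ℕ) :
    ‖∑ l ∈ Finset.range N, clifford W l * amplify (Finset ℕ) (T ^ e l)‖
      ≤ ‖A'‖ * (3 / 2 * √N) * ‖A‖ := by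
  have hpow : ∀ n, (A * T * A') ^ n * A = A * T ^ n := fun n => by
    induction n with
    | zero => simp
    | succ n ih =>
      rw [pow_succ, mul_assoc, mul_assoc (A * T), h, mul_one, ← mul_assoc, ih, mul_assoc,
        ← pow_succ]
  have hconj : ∀ n, A' * (A * T * A') ^ n * A = T ^ n := fun n => by
    rw [mul_assoc, hpow, ← mul_assoc, h, one_mul]
  have hX : ∑ l ∈ Finset.range N, clifford W l * amplify (Finset ℕ) (T ^ e l)
      = amplify (Finset ℕ) A' * (∑ l ∈ Finset.range N,
        clifford W l * amplify (Finset ℕ) ((A * T * A') ^ e l)) * amplify (Finset ℕ) A := by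
    rw [Finset.mul_sum, Finset.sum_mul]
    refine Finset.sum_congr rfl fun l _ => ?_
    rw [← mul_assoc, ← (clifford_amplify_comm A' l).eq, mul_assoc, mul_assoc, ← amplify_mul,
      ← amplify_mul, ← mul_assoc A', hconj]
  rw [hX]
  refine (norm_mul_le _ _).trans (mul_le_mul ((norm_mul_le _ _).trans ?_) (norm_amplify_le A)
    (norm_nonneg _) (by positivity))
  exact mul_le_mul (norm_amplify_le A') (norm_sum_clifford_mul_pow_le hle e N) (norm_nonneg _)
    (norm_nonneg _)

theorem sum_clifford_amplify_apply {E : Type*} [NormedAddCommGroup E] [NormedSpace ℂ E]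
    {F : ℕ → E →L[ℂ] E} (N : ℕ) (x : EllTwo (Finset ℕ) E) (s : Finset ℕ) :
    (∑ l ∈ Finset.range N, clifford E l * amplify (Finset ℕ) (F l)) x s
      = ∑ l ∈ Finset.range N, fermionSign s l • F l (x (symmDiff s {l})) := by
  rw [FunLike.coe_sum, Finset.sum_apply, lp.coeFn_sum, Finset.sum_apply]
  rfl

theorem natCast_le_norm_sum_clifford {W : Type*} [NormedAddCommGroup W]
    [InnerProductSpace ℂ W] {F : ℕ → W →L[ℂ] W} (N : ℕ) {u v : Finset ℕ → W}
    (hu : ∀ s, ‖u s‖ = 1) (hv : ∀ s, ‖v s‖ = 1)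
    (h : ∀ l s, ⟪v s, F l (u (symmDiff s {l}))⟫_ℂ = fermionSign s l) :
    (N : ℝ) ≤ ‖∑ l ∈ Finset.range N, clifford W l * amplify (Finset ℕ) (F l)‖ := by
  set X := ∑ l ∈ Finset.range N, clifford W l * amplify (Finset ℕ) (F l) with hX
  set P := (Finset.range N).powerset with hP
  have hcard : P.card = 2 ^ N := by simp [P]
  set x : EllTwo (Finset ℕ) W := ∑ s ∈ P, lp.single 2 s (u s) with hx
  set y : EllTwo (Finset ℕ) W := ∑ s ∈ P, lp.single 2 s (v s) with hy
  have hxn : ‖x‖ ^ 2 = 2 ^ N := by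
    rw [hx, norm_sum_single_sq _ hu, hcard, Nat.cast_pow, Nat.cast_ofNat]
  have hyn : ‖y‖ ^ 2 = 2 ^ N := by
    rw [hy, norm_sum_single_sq _ hv, hcard, Nat.cast_pow, Nat.cast_ofNat]
  have hxs : ∀ s ∈ P, x s = u s := fun s hs => by
    simp only [hx, lp.coeFn_sum, lp.coeFn_single, Finset.sum_apply, Finset.sum_pi_single, hs,
      if_true]
  have hin : ∀ s ∈ P, ⟪v s, X x s⟫_ℂ = N := fun s hs => by
    have e : ∀ l ∈ Finset.range N,
        ⟪v s, fermionSign s l • F l (x (symmDiff s {l}))⟫_ℂ = 1 := fun l hl => by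
      have hsl : symmDiff s {l} ∈ P := by
        rw [hP, Finset.mem_powerset] at hs ⊢
        intro j hj
        rcases Finset.mem_symmDiff.1 hj with h | h
        · exact hs h.1
        · rwa [Finset.mem_singleton.1 h.1]
      rw [hxs _ hsl, inner_smul_right, h, fermionSign_mul_self]
    rw [hX, sum_clifford_amplify_apply, inner_sum, Finset.sum_congr rfl e]
    simp
  have hinner : ⟪y, X x⟫_ℂ = 2 ^ N * N := by
    rw [hy, sum_inner]
    have : ∀ s ∈ P, ⟪(lp.single 2 s (v s) : EllTwo (Finset ℕ) W), X x⟫_ℂ = N := fun s hs => by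
      rw [lp.inner_single_left, hin s hs]
    rw [Finset.sum_congr rfl this, Finset.sum_const, hcard]
    simp
  have h1 := (norm_inner_le_norm (𝕜 := ℂ) y (X x)).trans
    (mul_le_mul_of_nonneg_left (X.le_opNorm x) (norm_nonneg _))
  have h2 : ‖y‖ = ‖x‖ := by
    rw [← sq_eq_sq₀ (norm_nonneg _) (norm_nonneg _), hxn, hyn]
  rw [hinner, norm_mul, norm_pow, norm_natCast, RCLike.norm_ofNat, h2, mul_left_comm, ← sq, hxn,
    mul_comm] at h1
  exact le_of_mul_le_mul_right h1 (by positivity)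

theorem one_lt_norm_conj_foguel {U : ℕ → W →L[ℂ] W} (hU : ∀ k, ‖U k‖ ≤ 1) {e : Finset ℕ → W}
    (he : ∀ s, ‖e s‖ = 1) (hUe : ∀ l s, ⟪e s, U l (e (symmDiff s {l}))⟫_ℂ = fermionSign s l)
    {A A' : EllTwo (Bool × ℕ) W →L[ℂ] EllTwo (Bool × ℕ) W} (h : A' * A = 1) :
    1 < ‖A * (foguelShift W + foguelHankel U) * A'‖ := by
  by_contra! hle
  set u : Bool → Finset ℕ → EllTwo (Bool × ℕ) W := fun b s => lp.single 2 (b, 0) (e s)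
  have hu : ∀ b s, ‖u b s‖ = 1 := fun b s => by
    rw [lp.norm_single (by simp), he]
  have hentry : ∀ l s, ⟪u false s,
      ((foguelShift W + foguelHankel U) ^ 2 ^ (l + 1)) (u true (symmDiff s {l}))⟫_ℂ
      = fermionSign s l := fun l s => by
    rw [lp.inner_single_left, foguel_pow_apply_single hU l, hUe]
  have hbound : ∀ N : ℕ, (N : ℝ) ≤ ‖A'‖ * (3 / 2 * √N) * ‖A‖ := fun N =>
    (natCast_le_norm_sum_clifford N (hu true) (hu false) hentry).trans
      (norm_sum_clifford_mul_pow_le_of_conj h hle _ N)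
  set K := ‖A'‖ * (3 / 2) * ‖A‖
  obtain ⟨n, hn⟩ := exists_nat_gt K
  have hK : 0 ≤ K := by positivity
  have h1 := hbound (n ^ 2)
  have hn0 : (0 : ℝ) < n := hK.trans_lt hn
  rw [Nat.cast_pow, Real.sqrt_sq hn0.le] at h1
  have h2 : (n : ℝ) ^ 2 ≤ K * n := h1.trans_eq (by ring)
  nlinarith

theorem inner_single_clifford_single (l : ℕ) (s : Finset ℕ) :
    ⟪(lp.single 2 s 1 : EllTwo (Finset ℕ) ℂ),
      clifford ℂ l (lp.single 2 (symmDiff s {l}) 1)⟫_ℂ = fermionSign s l := by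
  rw [lp.inner_single_left, clifford_apply, lp.single_apply_self]
  simp

end NotSimilar

theorem exists_linearIsometryEquiv_ellTwo {ι κ : Type*} (e : ℕ ≃ ι × κ) :
    Nonempty (EllTwo ι (EllTwo κ ℂ) ≃ₗᵢ[ℂ] EllTwo ℕ ℂ) := by
  classical
  set v : ℕ → EllTwo ι (EllTwo κ ℂ) := fun n => lp.single 2 (e n).1 (lp.single 2 (e n).2 1)
  have hin : ∀ n x, ⟪v n, x⟫_ℂ = x (e n).1 (e n).2 := fun n x => by
    rw [lp.inner_single_left, lp.inner_single_left]
    simp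
  have hv : Orthonormal ℂ v := by
    rw [orthonormal_iff_ite]
    intro m n
    rw [hin]
    split_ifs with h
    · subst h
      rw [lp.single_apply_self, lp.single_apply_self]
    · by_cases h1 : (e m).1 = (e n).1
      · have h2 : (e m).2 ≠ (e n).2 := fun h2 => h (e.injective (Prod.ext h1 h2))
        rw [h1, lp.single_apply_self, lp.single_apply_ne _ _ _ h2]
      · rw [lp.single_apply_ne _ _ _ h1]
        rfl
  have hspan : (Submodule.span ℂ (Set.range v))ᗮ = ⊥ := by
    rw [Submodule.eq_bot_iff]
    intro x hx
    ext i k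
    obtain ⟨n, hn⟩ := e.surjective (i, k)
    have := (Submodule.mem_orthogonal _ x).1 hx (v n) (Submodule.subset_span ⟨n, rfl⟩)
    rw [hin, hn] at this
    simpa using this
  exact ⟨(HilbertBasis.mkOfOrthogonalEqBot hv hspan).repr⟩

section Transfer

variable {H K : Type*} [NormedAddCommGroup H] [InnerProductSpace ℂ H] [NormedAddCommGroup K]
  [InnerProductSpace ℂ K]

/-- Conjugation by a linear isometry equivalence. -/
noncomputable def isometryConj (e : H ≃ₗᵢ[ℂ] K) : (H →L[ℂ] H) ≃A[ℂ] (K →L[ℂ] K) :=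
  e.toContinuousLinearEquiv.conjContinuousAlgEquiv

theorem norm_isometryConj_le (e : H ≃ₗᵢ[ℂ] K) (S : H →L[ℂ] H) : ‖isometryConj e S‖ ≤ ‖S‖ :=
  ContinuousLinearMap.opNorm_le_bound _ (norm_nonneg _) fun x => by
    change ‖e (S (e.symm x))‖ ≤ _
    rw [e.norm_map]
    exact (S.le_opNorm _).trans_eq (by rw [e.symm.norm_map])

theorem norm_isometryConj (e : H ≃ₗᵢ[ℂ] K) (S : H →L[ℂ] H) : ‖isometryConj e S‖ = ‖S‖ := by
  refine le_antisymm (norm_isometryConj_le e S) ?_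
  have : isometryConj e.symm (isometryConj e S) = S := by
    ext x
    change e.symm (e (S (e.symm (e x)))) = S x
    simp
  calc ‖S‖ = ‖isometryConj e.symm (isometryConj e S)‖ := by rw [this]
    _ ≤ ‖isometryConj e S‖ := norm_isometryConj_le _ _

end Transfer

theorem norm_aeval_le_iSup {H : Type*} [NormedAddCommGroup H] [InnerProductSpace ℂ H]
    {T : H →L[ℂ] H} {C : ℝ} (p : Polynomial ℂ)
    (h : ∀ M > 0, (∀ z : ℂ, ‖z‖ ≤ 1 → ‖p.eval z‖ ≤ M) → ‖Polynomial.aeval T p‖ ≤ C * M) :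
    ‖Polynomial.aeval T p‖ ≤ C * ⨆ z : Metric.closedBall (0 : ℂ) 1, ‖p.eval (z : ℂ)‖ := by
  set s := ⨆ z : Metric.closedBall (0 : ℂ) 1, ‖p.eval (z : ℂ)‖ with hs
  have hbdd : BddAbove (Set.range fun z : Metric.closedBall (0 : ℂ) 1 => ‖p.eval (z : ℂ)‖) := by
    have : CompactSpace (Metric.closedBall (0 : ℂ) 1) :=
      isCompact_iff_compactSpace.1 (isCompact_closedBall _ _)
    exact (isCompact_range (p.continuous.comp continuous_subtype_val).norm).bddAbove
  have hle : ∀ z : ℂ, ‖z‖ ≤ 1 → ‖p.eval z‖ ≤ s := fun z hz =>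
    le_ciSup hbdd (⟨z, by simpa using hz⟩ : Metric.closedBall (0 : ℂ) 1)
  have hs0 : 0 ≤ s := (norm_nonneg _).trans (hle 0 (by simp))
  have hlim : Filter.Tendsto (fun M => C * M) (nhdsWithin s (Set.Ioi s)) (nhds (C * s)) :=
    ((continuous_const.mul continuous_id).tendsto s).mono_left nhdsWithin_le_nhds
  refine ge_of_tendsto hlim ?_
  filter_upwards [self_mem_nhdsWithin] with M hM
  exact h M (hs0.trans_lt hM) fun z hz => (hle z hz).trans (le_of_lt hM)

theorem norm_single_one {ι : Type*} [DecidableEq ι] (i : ι) :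
    ‖(lp.single 2 i 1 : EllTwo ι ℂ)‖ = 1 := by
  rw [lp.norm_single (by simp), norm_one]

end Construction

/-- Pisier. There is a bounded operator on `ℓ²(ℕ, ℂ)` that is polynomially
bounded but not similar to a contraction. -/
theorem exists_polynomiallyBounded_not_similar_contraction :
    ∃ T : lp (fun _ : ℕ => ℂ) 2 →L[ℂ] lp (fun _ : ℕ => ℂ) 2,
      (∃ C > (0 : ℝ), ∀ p : Polynomial ℂ,
        ‖Polynomial.aeval T p‖ ≤ C * ⨆ z : Metric.closedBall (0 : ℂ) 1, ‖p.eval (z : ℂ)‖) ∧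
      (∀ A A' : lp (fun _ : ℕ => ℂ) 2 →L[ℂ] lp (fun _ : ℕ => ℂ) 2,
        A * A' = 1 → A' * A = 1 → 1 < ‖A * T * A'‖) := by
  obtain ⟨f⟩ : Nonempty (ℕ ≃ (Bool × ℕ) × Finset ℕ) := nonempty_equiv_of_countable
  obtain ⟨e⟩ := exists_linearIsometryEquiv_ellTwo f
  set S := foguelShift (EllTwo (Finset ℕ) ℂ) + foguelHankel (clifford ℂ)
  refine ⟨isometryConj e S, ⟨8465, by norm_num, fun p => ?_⟩, fun A A' _ hA => ?_⟩
  · refine norm_aeval_le_iSup p fun M hM hp => ?_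
    have h1 : Polynomial.aeval (isometryConj e S) p = isometryConj e (Polynomial.aeval S p) :=
      Polynomial.aeval_algHom_apply (isometryConj e) S p
    rw [h1, norm_isometryConj]
    exact norm_aeval_foguel_le norm_linComb_clifford_le norm_clifford_le hM hp
  · set Φ := isometryConj e
    have h1 : Φ.symm A' * Φ.symm A = 1 := by rw [← map_mul, hA, map_one]
    have h2 := one_lt_norm_conj_foguel (U := clifford ℂ) (e := fun s => lp.single 2 s 1)
      norm_clifford_le norm_single_one inner_single_clifford_single h1
    rw [← norm_isometryConj e] at h2
    change 1 < ‖Φ (Φ.symm A * S * Φ.symm A')‖ at h2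
    rwa [map_mul, map_mul, Φ.apply_symm_apply, Φ.apply_symm_apply] at h2
end
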